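/- arXiv:0904.0262 — 2 statements merged into one kernel-verified Lean document; each statement's English description precedes it below -/
import Mathlib

section
/- For all integers ℓ ≥ 3 and even k ≥ 4, every finite set of at least (ℓ−1)(k−2)/2 + 2 points in the plane in convex position contains ℓ collinear points or k points in strictly convex position. -/
noncomputable section

/-- A point in the plane. -/
abbrev Pt : Type := EuclideanSpace ℝ (Fin 2)

noncomputable instance : DecidableEq Pt := Classical.decEq _

/-- A finite point set is in general position if no three of its points are collinear. -/
def GenPos (P : Finset Pt) : Prop :=
  ∀ S ⊆ P, S.card = 3 → ¬ Collinear ℝ (S : Set Pt)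

/-- A finite point set is in convex position if every point lies on the boundary
of the convex hull of the set. -/
def ConvexPos (P : Finset Pt) : Prop :=
  ∀ p ∈ P, p ∈ frontier (convexHull ℝ (P : Set Pt))

/-- `v` is a corner of `P` if removing it changes the convex hull. -/
def IsCornerOf (P : Finset Pt) (v : Pt) : Prop :=
  convexHull ℝ ((P : Set Pt) \ {v}) ≠ convexHull ℝ (P : Set Pt)

/-- A finite point set is in strictly convex position if each of its points is a corner. -/
def StrictConvexPos (P : Finset Pt) : Prop :=
  ∀ v ∈ P, IsCornerOf P v

/-- `P` contains `k` points in convex position. -/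
def HasConvex (P : Finset Pt) (k : ℕ) : Prop :=
  ∃ S ⊆ P, S.card = k ∧ ConvexPos S

/-- `P` contains `k` points in strictly convex position. -/
def HasStrictConvex (P : Finset Pt) (k : ℕ) : Prop :=
  ∃ S ⊆ P, S.card = k ∧ StrictConvexPos S

/-- `P` contains `l` collinear points. -/
def HasCollinear (P : Finset Pt) (l : ℕ) : Prop :=
  ∃ S ⊆ P, S.card = l ∧ Collinear ℝ (S : Set Pt)

/-- The Erdős–Szekeres number: the least `n` such that every finite set of at least `n`
points in general position contains `k` points in convex position. -/
def ES (k : ℕ) : ℕ :=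
  sInf {n : ℕ | ∀ P : Finset Pt, GenPos P → n ≤ P.card → HasConvex P k}

/-- `X` is a `k`-hole of `P`: `k` points of `P` in strictly convex position whose
convex hull contains no other point of `P`. -/
def IsHole (P X : Finset Pt) (k : ℕ) : Prop :=
  X ⊆ P ∧ X.card = k ∧ StrictConvexPos X ∧
    convexHull ℝ (X : Set Pt) ∩ (P : Set Pt) = (X : Set Pt)

/-- `v` and `w` are visible with respect to `P`. -/
def Visible (P : Finset Pt) (v w : Pt) : Prop :=
  v ≠ w ∧ (P : Set Pt) ∩ segment ℝ v w = {v, w}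

end

def NoThree (S : Finset Pt) : Prop :=
  ∀ a ∈ S, ∀ b ∈ S, ∀ c ∈ S, a ≠ b → a ≠ c → b ≠ c → ¬ Collinear ℝ ({a, b, c} : Set Pt)

def Supp (P : Finset Pt) : Prop :=
  ∀ p ∈ P, ∃ f : Pt →L[ℝ] ℝ, f ≠ 0 ∧ ∀ q ∈ P, f q ≤ f p

lemma col_swap {a b c : Pt} (h : Collinear ℝ ({a, b, c} : Set Pt)) :
    Collinear ℝ ({b, a, c} : Set Pt) := by
  rwa [Set.insert_comm]

lemma col_rot {a b c : Pt} (h : Collinear ℝ ({a, b, c} : Set Pt)) :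
    Collinear ℝ ({c, a, b} : Set Pt) := by
  convert h using 1
  ext x; simp; tauto

lemma noThree_insert {S : Finset Pt} (hS : NoThree S) (y : Pt)
    (hy : ∀ p ∈ S, ∀ q ∈ S, p ≠ q → p ≠ y → q ≠ y → ¬ Collinear ℝ ({y, p, q} : Set Pt)) :
    NoThree (insert y S) := by
  intro a ha b hb c hc hab hac hbc hcol
  rw [Finset.mem_insert] at ha hb hc
  rcases ha with rfl | ha
  · exact hy b (hb.resolve_left hab.symm) c (hc.resolve_left hac.symm) hbc hab.symm hac.symm hcol
  · rcases hb with rfl | hb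
    · exact hy a ha c (hc.resolve_left hbc.symm) hac hab hbc.symm (col_swap hcol)
    · rcases hc with rfl | hc
      · exact hy a ha b hb hab hac hbc (col_rot hcol)
      · exact hS a ha b hb c hc hab hac hbc hcol

/-- points on a level set of a nonzero functional are collinear -/
lemma col_level (f : Pt →L[ℝ] ℝ) (hf : f ≠ 0) (s : Set Pt) (t : ℝ) (hs : ∀ x ∈ s, f x = t) :
    Collinear ℝ s := by
  rw [collinear_iff_finrank_le_one]
  have h1 : vectorSpan ℝ s ≤ LinearMap.ker (f : Pt →ₗ[ℝ] ℝ) := by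
    rw [vectorSpan_def, Submodule.span_le]
    rintro _ ⟨x, hx, y, hy, rfl⟩
    simp [hs x hx, hs y hy]
  have h2 := Submodule.finrank_mono h1
  have h3 := LinearMap.finrank_range_add_finrank_ker (f : Pt →ₗ[ℝ] ℝ)
  have h4 : Module.finrank ℝ Pt = 2 := by simp
  have h5 : Module.finrank ℝ (LinearMap.range (f : Pt →ₗ[ℝ] ℝ)) ≠ 0 := by
    intro h
    rw [Submodule.finrank_eq_zero, LinearMap.range_eq_bot] at h
    apply hf
    ext x
    exact congrArg (fun g : Pt →ₗ[ℝ] ℝ => g _) h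
  omega

lemma sbtw_eq (f : Pt →L[ℝ] ℝ) {a b c : Pt} (h : Sbtw ℝ a b c) (ha : f a ≤ f b) (hc : f c ≤ f b) :
    f a = f b ∧ f c = f b := by
  have h' := sbtw_iff_mem_image_Ioo_and_ne.1 h
  obtain ⟨⟨t, ⟨ht0, ht1⟩, rfl⟩, -⟩ := h'
  have e : f (AffineMap.lineMap a c t) = (1 - t) * f a + t * f c := by
    rw [AffineMap.lineMap_apply_module]; simp
  rw [e] at ha hc ⊢
  constructor <;> nlinarith

lemma trich {a b c : Pt} (h : Collinear ℝ ({a, b, c} : Set Pt)) (hab : a ≠ b) (hac : a ≠ c)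
    (hbc : b ≠ c) : Sbtw ℝ a b c ∨ Sbtw ℝ b c a ∨ Sbtw ℝ c a b := by
  rcases h.wbtw_or_wbtw_or_wbtw with h | h | h
  · exact Or.inl ⟨h, hab.symm, hbc⟩
  · exact Or.inr (Or.inl ⟨h, hbc.symm, hac.symm⟩)
  · exact Or.inr (Or.inr ⟨h, hac, hab⟩)

lemma supp_line {P : Finset Pt} (hP : Supp P) {a b c : Pt} (ha : a ∈ P) (hb : b ∈ P) (hc : c ∈ P)
    (h : Collinear ℝ ({a, b, c} : Set Pt)) (hab : a ≠ b) (hac : a ≠ c) (hbc : b ≠ c) :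
    ∃ f : Pt →L[ℝ] ℝ, f ≠ 0 ∧ (∀ q ∈ P, f q ≤ f a) ∧ f b = f a ∧ f c = f a := by
  rcases trich h hab hac hbc with h | h | h
  · obtain ⟨f, hf, hm⟩ := hP b hb
    obtain ⟨h1, h2⟩ := sbtw_eq f h (hm _ ha) (hm _ hc)
    exact ⟨f, hf, by rwa [h1], h1.symm, by rw [h1, h2]⟩
  · obtain ⟨f, hf, hm⟩ := hP c hc
    obtain ⟨h1, h2⟩ := sbtw_eq f h (hm _ hb) (hm _ ha)
    exact ⟨f, hf, by rwa [h2], by rw [h1, h2], h2.symm⟩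
  · obtain ⟨f, hf, hm⟩ := hP a ha
    obtain ⟨h1, h2⟩ := sbtw_eq f h (hm _ hc) (hm _ hb)
    exact ⟨f, hf, hm, h2, h1⟩

lemma mem_line {a b c p q : Pt} (hp : p ∈ line[ℝ, a, b]) (hq : q ∈ line[ℝ, a, b]) (hpq : p ≠ q)
    (h : Collinear ℝ ({p, q, c} : Set Pt)) : c ∈ line[ℝ, a, b] := by
  have h1 : c ∈ line[ℝ, p, q] :=
    h.mem_affineSpan_of_mem_of_ne (by simp) (by simp) (by simp) hpq
  exact (affineSpan_pair_le_of_mem_of_mem hp hq) h1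

/-- all collinear triples of `Q` through `b` lie on the line `L` -/
def Deg1 (Q : Finset Pt) (L : AffineSubspace ℝ Pt) (b : Pt) : Prop :=
  ∀ u ∈ Q, ∀ v ∈ Q, u ≠ v → u ≠ b → v ≠ b → Collinear ℝ ({b, u, v} : Set Pt) → u ∈ L ∧ v ∈ L

lemma mid_deg1 {P Q : Finset Pt} (hP : Supp P) (hQ : Q ⊆ P) {a b c x z : Pt} (ha : a ∈ Q)
    (hb : b ∈ Q) (hc : c ∈ Q) (h : Sbtw ℝ a b c) (haL : a ∈ line[ℝ, x, z])
    (hbL : b ∈ line[ℝ, x, z]) : Deg1 Q line[ℝ, x, z] b := by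
  intro u hu v hv huv hub hvb hcol
  obtain ⟨f, hf, hm, h1, h2⟩ := supp_line hP (hQ hb) (hQ hu) (hQ hv) hcol hub.symm hvb.symm huv
  obtain ⟨h3, h4⟩ := sbtw_eq f h (hm _ (hQ ha)) (hm _ (hQ hc))
  constructor
  · refine mem_line haL hbL h.ne_left.symm (col_level f hf _ (f b) ?_)
    simp [h1, h3]
  · refine mem_line haL hbL h.ne_left.symm (col_level f hf _ (f b) ?_)
    simp [h2, h3]

lemma step {Q R : Finset Pt} {n N l : ℕ} (hR : R ⊆ Q) (hRc : R.card ≤ l - 1)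
    (ih : ∀ Q' ⊆ Q, N ≤ Q'.card → ∃ S ⊆ Q', S.card = n ∧ NoThree S)
    (hc : N + (l - 1) ≤ Q.card) {y u : Pt} (hy : y ∈ R) (hu : u ∈ R) (hyu : y ≠ u)
    (h1 : ∀ p ∈ Q, ∀ q ∈ Q, (p ∉ R ∨ p = u) → (q ∉ R ∨ q = u) → p ≠ q → p ≠ y → q ≠ y →
      ¬ Collinear ℝ ({y, p, q} : Set Pt))
    (h2 : ∀ p ∈ Q, ∀ q ∈ Q, p ∉ R → q ∉ R → p ≠ q → p ≠ u → q ≠ u →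
      ¬ Collinear ℝ ({u, p, q} : Set Pt)) :
    ∃ S ⊆ Q, S.card = n + 2 ∧ NoThree S := by
  obtain ⟨S, hS, hSc, hS3⟩ := ih (Q \ R) Finset.sdiff_subset (by
    rw [Finset.card_sdiff_of_subset hR]; omega)
  have hS' : ∀ p ∈ S, p ∈ Q ∧ p ∉ R := fun p hp => Finset.mem_sdiff.1 (hS hp)
  have huS : u ∉ S := fun h => (hS' u h).2 hu
  have hyS : y ∉ insert u S := by
    rw [Finset.mem_insert, not_or]
    exact ⟨hyu, fun h => (hS' y h).2 hy⟩
  refine ⟨insert y (insert u S), ?_, ?_, ?_⟩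
  · intro p hp
    rw [Finset.mem_insert, Finset.mem_insert] at hp
    rcases hp with rfl | rfl | hp
    · exact hR hy
    · exact hR hu
    · exact (hS' p hp).1
  · rw [Finset.card_insert_of_notMem hyS, Finset.card_insert_of_notMem huS, hSc]
  · have key : ∀ p ∈ insert u S, p ∈ Q ∧ (p ∉ R ∨ p = u) := by
      intro p hp
      rw [Finset.mem_insert] at hp
      rcases hp with rfl | hp
      · exact ⟨hR hu, Or.inr rfl⟩
      · exact ⟨(hS' p hp).1, Or.inl (hS' p hp).2⟩
    refine noThree_insert (noThree_insert hS3 u ?_) y ?_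
    · intro p hp q hq
      exact h2 p (hS' p hp).1 q (hS' q hq).1 (hS' p hp).2 (hS' q hq).2
    · intro p hp q hq
      exact h1 p (key p hp).1 q (key q hq).1 (key p hp).2 (key q hq).2

/-- two degree-one points on the same line -/
lemma step_two {Q : Finset Pt} {n N l : ℕ} 
    (hnc : ∀ S ⊆ Q, Collinear ℝ (S : Set Pt) → S.card ≤ l - 1)
    (ih : ∀ Q' ⊆ Q, N ≤ Q'.card → ∃ S ⊆ Q', S.card = n ∧ NoThree S)
    (hc : N + (l - 1) ≤ Q.card) {x z y u : Pt} (hy : y ∈ Q) (hu : u ∈ Q) (hyu : y ≠ u)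
    (hyL : y ∈ line[ℝ, x, z]) (huL : u ∈ line[ℝ, x, z])
    (h1 : Deg1 Q line[ℝ, x, z] y) (h2 : Deg1 Q line[ℝ, x, z] u) :
    ∃ S ⊆ Q, S.card = n + 2 ∧ NoThree S := by
  classical
  have hR : ∀ p, p ∈ Q.filter (fun p => p ∈ line[ℝ, x, z]) ↔ p ∈ Q ∧ p ∈ line[ℝ, x, z] := by
    intro p; simp
  refine step (R := Q.filter (fun p => p ∈ line[ℝ, x, z])) (Finset.filter_subset _ _)
    (hnc _ (Finset.filter_subset _ _) ?_) ih hc ((hR _).2 ⟨hy, hyL⟩) ((hR _).2 ⟨hu, huL⟩) hyu ?_ ?_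
  · refine Collinear.subset (s₂ := (line[ℝ, x, z] : Set Pt)) ?_ (by
      rw [Collinear, ← direction_affineSpan, AffineSubspace.affineSpan_coe, direction_affineSpan]
      exact collinear_pair ℝ x z)
    intro p hp
    exact ((hR p).1 hp).2
  · intro p hp q hq hp' hq' hpq hpy hqy hcol
    obtain ⟨a, b⟩ := h1 p hp q hq hpq hpy hqy hcol
    have e1 := hp'.resolve_left (fun h => h ((hR p).2 ⟨hp, a⟩))
    have e2 := hq'.resolve_left (fun h => h ((hR q).2 ⟨hq, b⟩))
    exact hpq (e1.trans e2.symm)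
  · intro p hp q hq hp' hq' hpq hpy hqy hcol
    obtain ⟨a, b⟩ := h2 p hp q hq hpq hpy hqy hcol
    exact hp' ((hR p).2 ⟨hp, a⟩)

/-- if the ends are not of degree one and there is one middle point only, the line has 3 points -/
lemma only_three {P Q : Finset Pt} (hP : Supp P) (hQ : Q ⊆ P) {x y z : Pt}
    (hx : x ∈ Q) (hy : y ∈ Q) (hz : z ∈ Q) (h : Sbtw ℝ x y z)
    (H : ∀ b ∈ Q, ∀ b' ∈ Q, b ∈ line[ℝ, x, z] → b' ∈ line[ℝ, x, z] → Deg1 Q line[ℝ, x, z] b →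
      Deg1 Q line[ℝ, x, z] b' → b = b') :
    ∀ w ∈ Q, w ∈ line[ℝ, x, z] → w = x ∨ w = y ∨ w = z := by
  intro w hw hwL
  by_contra hne
  push Not at hne
  obtain ⟨n1, n2, n3⟩ := hne
  have hxL := left_mem_affineSpan_pair ℝ x z
  have hzL := right_mem_affineSpan_pair ℝ x z
  have hyL : y ∈ line[ℝ, x, z] := h.wbtw.mem_affineSpan
  have hxz := h.left_ne_right
  have dy := mid_deg1 hP hQ hx hy hz h hxL hyL
  have hcol : Collinear ℝ ({x, w, z} : Set Pt) :=
    collinear_triple_of_mem_affineSpan_pair hxL hwL hzL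
  rcases trich hcol n1.symm hxz n3 with h' | h' | h'
  · exact n2 (H _ hw _ hy hwL hyL (mid_deg1 hP hQ hx hw hz h' hxL hwL) dy)
  · exact h.ne_right (H _ hy _ hz hyL hzL dy (mid_deg1 hP hQ hw hz hx h' hwL hzL))
  · exact h.ne_left (H _ hy _ hx hyL hxL dy (mid_deg1 hP hQ hz hx hw h' hzL hxL))

lemma ind {P : Finset Pt} (hP : Supp P) {l : ℕ} (hl : 3 ≤ l)
    (hnc : ∀ S ⊆ P, Collinear ℝ (S : Set Pt) → S.card ≤ l - 1) (m : ℕ) :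
    ∀ Q ⊆ P, (l - 1) * m + 2 ≤ Q.card → ∃ S ⊆ Q, S.card = 2 * m + 2 ∧ NoThree S := by
  induction m with
  | zero =>
    intro Q hQ hc
    obtain ⟨S, hS, hSc⟩ := Finset.exists_subset_card_eq (s := Q) (n := 2) (by omega)
    refine ⟨S, hS, by omega, ?_⟩
    intro a ha b hb c hc hab hac hbc
    exfalso
    have h3 : ({a, b, c} : Finset Pt).card = 3 := Finset.card_eq_three.2 ⟨a, b, c, hab, hac, hbc, rfl⟩
    have : ({a, b, c} : Finset Pt) ⊆ S := by
      intro p hp; simp at hp; rcases hp with rfl | rfl | rfl <;> assumption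
    have := Finset.card_le_card this
    omega
  | succ m ih =>
    intro Q hQ hc
    have hc' : ((l - 1) * m + 2) + (l - 1) ≤ Q.card := by
      rw [Nat.mul_succ] at hc; omega
    have ih' : ∀ Q' ⊆ Q, (l - 1) * m + 2 ≤ Q'.card → ∃ S ⊆ Q', S.card = 2 * m + 2 ∧ NoThree S :=
      fun Q' h => ih Q' (h.trans hQ)
    have hncQ : ∀ S ⊆ Q, Collinear ℝ (S : Set Pt) → S.card ≤ l - 1 := fun S h => hnc S (h.trans hQ)
    by_cases h3 : NoThree Q
    · have : 2 * (m + 1) + 2 ≤ Q.card := by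
        have := Nat.mul_le_mul_right (m + 1) (show 2 ≤ l - 1 by omega)
        omega
      obtain ⟨S, hS, hSc⟩ := Finset.exists_subset_card_eq this
      exact ⟨S, hS, hSc, fun a ha b hb c hc => h3 a (hS ha) b (hS hb) c (hS hc)⟩
    by_cases H : ∃ x z : Pt, ∃ y ∈ Q, ∃ u ∈ Q, y ≠ u ∧ y ∈ line[ℝ, x, z] ∧ u ∈ line[ℝ, x, z] ∧
        Deg1 Q line[ℝ, x, z] y ∧ Deg1 Q line[ℝ, x, z] u
    · obtain ⟨x, z, y, hy, u, hu, hyu, hyL, huL, h1, h2⟩ := H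
      exact step_two hncQ ih' hc' hy hu hyu hyL huL h1 h2
    have H' : ∀ x z : Pt, ∀ b ∈ Q, ∀ b' ∈ Q, b ∈ line[ℝ, x, z] → b' ∈ line[ℝ, x, z] →
        Deg1 Q line[ℝ, x, z] b → Deg1 Q line[ℝ, x, z] b' → b = b' := by
      intro x z b hb b' hb' h1 h2 h3 h4
      by_contra hne
      exact H ⟨x, z, b, hb, b', hb', hne, h1, h2, h3, h4⟩
    -- a middle point
    have hmid : ∃ x ∈ Q, ∃ y ∈ Q, ∃ z ∈ Q, Sbtw ℝ x y z := by
      unfold NoThree at h3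
      push Not at h3
      obtain ⟨a, ha, b, hb, c, hc, hab, hac, hbc, hcol⟩ := h3
      rcases trich hcol hab hac hbc with h | h | h
      exacts [⟨_, ha, _, hb, _, hc, h⟩, ⟨_, hb, _, hc, _, ha, h⟩, ⟨_, hc, _, ha, _, hb, h⟩]
    obtain ⟨x, hx, y, hy, z, hz, hs⟩ := hmid
    have hxL := left_mem_affineSpan_pair ℝ x z
    have hzL := right_mem_affineSpan_pair ℝ x z
    have hyL : y ∈ line[ℝ, x, z] := hs.wbtw.mem_affineSpan
    have dy := mid_deg1 hP hQ hx hy hz hs hxL hyL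
    have o1 := only_three hP hQ hx hy hz hs (H' x z)
    have hnz : ¬ Deg1 Q line[ℝ, x, z] z := fun h => hs.ne_right (H' x z y hy z hz hyL hzL dy h)
    -- second line
    have hsec : ∃ u ∈ Q, ∃ v ∈ Q, Sbtw ℝ z u v ∧ u ∉ line[ℝ, x, z] := by
      unfold Deg1 at hnz
      push Not at hnz
      obtain ⟨u, hu, v, hv, huv, huz, hvz, hcol, hnot⟩ := hnz
      have huL : u ∉ line[ℝ, x, z] := by
        intro h
        exact hnot h (mem_line hzL h huz.symm hcol)
      have hvL : v ∉ line[ℝ, x, z] := by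
        intro h
        refine huL (mem_line hzL h hvz.symm ?_)
        rwa [Set.pair_comm v u]
      rcases trich hcol huz.symm hvz.symm huv with h | h | h
      · exact ⟨u, hu, v, hv, h, huL⟩
      · exact ⟨v, hv, u, hu, h.symm, hvL⟩
      · exfalso
        have hzM : z ∈ line[ℝ, v, u] := h.wbtw.mem_affineSpan
        have dz := mid_deg1 hP hQ hv hz hu h (left_mem_affineSpan_pair ℝ v u) hzM
        have hcol2 : Collinear ℝ ({z, x, y} : Set Pt) :=
          collinear_triple_of_mem_affineSpan_pair hzL hxL hyL
        obtain ⟨hxM, hyM⟩ := dz x hx y hy hs.ne_left.symm hs.left_ne_right hs.ne_right hcol2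
        refine huL (mem_line hxL hzL hs.left_ne_right ?_)
        exact collinear_triple_of_mem_affineSpan_pair hxM hzM (right_mem_affineSpan_pair ℝ v u)
    obtain ⟨u, hu, v, hv, hs2, huL⟩ := hsec
    have huM : u ∈ line[ℝ, z, v] := hs2.wbtw.mem_affineSpan
    have du := mid_deg1 hP hQ hz hu hv hs2 (left_mem_affineSpan_pair ℝ z v) huM
    have o2 := only_three hP hQ hz hu hv hs2 (H' z v)
    have hyu : y ≠ u := by rintro rfl; exact huL hyL
    have hl4 : 3 ≤ l - 1 := by
      have h3 : ({x, y, z} : Finset Pt).card = 3 :=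
        Finset.card_eq_three.2 ⟨x, y, z, hs.ne_left.symm, hs.left_ne_right, hs.ne_right, rfl⟩
      rw [← h3]
      apply hncQ
      · intro p hp; simp at hp; rcases hp with rfl | rfl | rfl <;> assumption
      · simpa using hs.wbtw.collinear
    refine step (R := {y, z, u}) ?_ (Finset.card_le_three.trans hl4) ih' hc' (y := y) (u := u)
      (by simp) (by simp) hyu ?_ ?_
    · intro p hp; simp at hp; rcases hp with rfl | rfl | rfl <;> assumption
    · intro p hp q hq hp' hq' hpq hpy hqy hcol
      obtain ⟨a, b⟩ := dy p hp q hq hpq hpy hqy hcol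
      have key : ∀ p ∈ Q, p ∈ line[ℝ, x, z] → p ≠ y → (p ∉ ({y, z, u} : Finset Pt) ∨ p = u) → p = x := by
        intro p hp hpL hpy hpR
        rcases hpR with hpR | rfl
        · rcases o1 p hp hpL with h | h | h
          · exact h
          · exact absurd h hpy
          · exact absurd (by simp [h]) hpR
        · exact absurd hpL huL
      exact hpq ((key p hp a hpy hp').trans (key q hq b hqy hq').symm)
    · intro p hp q hq hp' hq' hpq hpu hqu hcol
      obtain ⟨a, b⟩ := du p hp q hq hpq hpu hqu hcol
      have key : ∀ p ∈ Q, p ∈ line[ℝ, z, v] → p ≠ u → p ∉ ({y, z, u} : Finset Pt) → p = v := by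
        intro p hp hpL hpu hpR
        rcases o2 p hp hpL with h | h | h
        · exact absurd (by simp [h]) hpR
        · exact absurd h hpu
        · exact h
      exact hpq ((key p hp a hpu hp').trans (key q hq b hqu hq').symm)

lemma supp_of_convexPos {P : Finset Pt} (hconv : ConvexPos P) (hn : ¬ Collinear ℝ (P : Set Pt)) :
    Supp P := by
  have htop : affineSpan ℝ (P : Set Pt) = ⊤ := by
    have hne : (P : Set Pt).Nonempty := by
      rw [Set.nonempty_iff_ne_empty]
      intro h; rw [h] at hn; exact hn (collinear_empty ℝ Pt)
    rw [AffineSubspace.affineSpan_eq_top_iff_vectorSpan_eq_top_of_nonempty ℝ Pt Pt hne]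
    apply Submodule.eq_top_of_finrank_eq
    rw [collinear_iff_finrank_le_one] at hn
    have h1 := Submodule.finrank_le (vectorSpan ℝ (P : Set Pt))
    have h2 : Module.finrank ℝ Pt = 2 := by simp
    omega
  have hint : (interior (convexHull ℝ (P : Set Pt))).Nonempty :=
    interior_convexHull_nonempty_iff_affineSpan_eq_top.2 htop
  have hcv : Convex ℝ (convexHull ℝ (P : Set Pt)) := convex_convexHull ℝ _
  intro p hp
  have hpf : p ∉ interior (convexHull ℝ (P : Set Pt)) := (hconv p hp).2
  obtain ⟨f, hf⟩ := geometric_hahn_banach_open_point hcv.interior isOpen_interior hpf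
  refine ⟨f, ?_, ?_⟩
  · rintro rfl
    obtain ⟨w, hw⟩ := hint
    simpa using hf w hw
  · intro q hq
    have hqc : q ∈ closure (interior (convexHull ℝ (P : Set Pt))) := by
      rw [hcv.closure_interior_eq_closure_of_nonempty_interior hint]
      exact subset_closure (subset_convexHull ℝ _ hq)
    have hcl : IsClosed {x : Pt | f x ≤ f p} := isClosed_le f.continuous continuous_const
    exact closure_minimal (fun x hx => (hf x hx).le) hcl hqc

lemma strict_of_noThree {P S : Finset Pt} (hP : Supp P) (hS : S ⊆ P) (h3 : NoThree S) :
    StrictConvexPos S := by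
  intro v hv heq
  have hvc : v ∈ convexHull ℝ ((S.erase v : Finset Pt) : Set Pt) := by
    rw [Finset.coe_erase, heq]
    exact subset_convexHull ℝ _ hv
  obtain ⟨f, hf, hm⟩ := hP v (hS hv)
  rw [Finset.mem_convexHull'] at hvc
  obtain ⟨w, hw0, hw1, hwv⟩ := hvc
  have hsum : ∑ y ∈ S.erase v, w y * (f v - f y) = 0 := by
    have h1 : f v = ∑ y ∈ S.erase v, w y * f y := by
      conv_lhs => rw [← hwv]
      simp
    simp only [mul_sub, Finset.sum_sub_distrib, ← Finset.sum_mul, hw1]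
    rw [← h1]; ring
  have hz : ∀ y ∈ S.erase v, w y ≠ 0 → f y = f v := by
    intro y hy hwy
    rw [Finset.sum_eq_zero_iff_of_nonneg] at hsum
    · have := hsum y hy
      rcases mul_eq_zero.1 this with h | h
      · exact absurd h hwy
      · linarith
    · intro i hi
      exact mul_nonneg (hw0 i hi) (sub_nonneg.2 (hm i (hS (Finset.mem_of_mem_erase hi))))
  have hp : ∃ p ∈ S.erase v, w p ≠ 0 := by
    by_contra hno
    push Not at hno
    rw [Finset.sum_eq_zero hno] at hw1
    exact zero_ne_one hw1
  obtain ⟨p, hp, hwp⟩ := hp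
  have hq : ∃ q ∈ S.erase v, q ≠ p ∧ w q ≠ 0 := by
    by_contra hno
    push Not at hno
    rw [Finset.sum_eq_single_of_mem p hp hno] at hw1
    rw [Finset.sum_eq_single_of_mem p hp (fun b hb hbp => by rw [hno b hb hbp, zero_smul]), hw1,
      one_smul] at hwv
    exact (Finset.ne_of_mem_erase hp) hwv
  obtain ⟨q, hq, hqp, hwq⟩ := hq
  refine h3 v hv p (Finset.mem_of_mem_erase hp) q (Finset.mem_of_mem_erase hq)
    (Finset.ne_of_mem_erase hp).symm (Finset.ne_of_mem_erase hq).symm hqp.symm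
    (col_level f hf _ (f v) ?_)
  simp [hz p hp hwp, hz q hq hwq]

theorem stmt6 (l k : ℕ) (hl : 3 ≤ l) (hk : 4 ≤ k) (heven : Even k)
    (P : Finset Pt) (hconv : ConvexPos P)
    (hcard : (l - 1) * (k - 2) / 2 + 2 ≤ P.card) :
    HasCollinear P l ∨ HasStrictConvex P k := by
  by_cases hcol : HasCollinear P l
  · exact Or.inl hcol
  right
  have hnc : ∀ S ⊆ P, Collinear ℝ (S : Set Pt) → S.card ≤ l - 1 := by
    intro S hS hSc
    by_contra hlt
    obtain ⟨T, hT, hTc⟩ := Finset.exists_subset_card_eq (s := S) (n := l) (by omega)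
    exact hcol ⟨T, hT.trans hS, hTc, hSc.subset (by exact_mod_cast hT)⟩
  obtain ⟨m, rfl⟩ : ∃ m, k = 2 * (m + 1) + 2 := by
    obtain ⟨r, hr⟩ := heven
    exact ⟨r - 2, by omega⟩
  have e : (l - 1) * (2 * (m + 1) + 2 - 2) / 2 = (l - 1) * (m + 1) := by
    rw [Nat.add_sub_cancel, Nat.mul_left_comm, Nat.mul_div_cancel_left _ (by norm_num)]
  rw [e] at hcard
  have hn : ¬ Collinear ℝ (P : Set Pt) := by
    intro h
    have h1 := hnc P (Finset.Subset.refl _) h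
    rw [Nat.mul_succ] at hcard
    omega
  have hP := supp_of_convexPos hconv hn
  obtain ⟨S, hS, hSc, hS3⟩ := ind hP hl hnc (m + 1) P (Finset.Subset.refl _) hcard
  exact ⟨S, hS, hSc, strict_of_noThree hP hS hS3⟩
end

section
/- For all integers ℓ ≥ 3 and even k ≥ 4, ES(k,ℓ) ≤ ES((k−2)(ℓ−1)/2 + 2); that is, every finite set of at least ES((k−2)(ℓ−1)/2 + 2) points in the plane contains ℓ collinear points or k points in strictly convex position. -/
/-- orientation of a triple -/
noncomputable def ori (a b c : Pt) : ℝ :=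
  (b 0 - a 0) * (c 1 - a 1) - (b 1 - a 1) * (c 0 - a 0)

theorem pt_ext {a b : Pt} (h0 : a 0 = b 0) (h1 : a 1 = b 1) : a = b := by
  ext i; fin_cases i
  · exact h0
  · exact h1

theorem ori_rot (a b c : Pt) : ori b c a = ori a b c := by unfold ori; ring
theorem ori_swap (a b c : Pt) : ori a c b = - ori a b c := by unfold ori; ring
theorem ori_self1 (a b : Pt) : ori a a b = 0 := by unfold ori; ring
theorem ori_self2 (a b : Pt) : ori a b b = 0 := by unfold ori; ring
theorem ori_self3 (a b : Pt) : ori a b a = 0 := by unfold ori; ring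

theorem ori_param {a b c : Pt} (hac : a ≠ c) (h : ori a b c = 0) :
    ∃ t : ℝ, b 0 = a 0 + t * (c 0 - a 0) ∧ b 1 = a 1 + t * (c 1 - a 1) := by
  unfold ori at h
  by_cases h0 : c 0 - a 0 = 0
  · have h1 : c 1 - a 1 ≠ 0 := fun h1 => hac (pt_ext (by linarith) (by linarith))
    refine ⟨(b 1 - a 1) / (c 1 - a 1), ?_, ?_⟩
    · rw [h0] at h ⊢
      have : (b 0 - a 0) = 0 := by
        have : (b 0 - a 0) * (c 1 - a 1) = 0 := by linarith
        exact (mul_eq_zero.1 this).resolve_right h1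
      linarith
    · field_simp; ring
  · refine ⟨(b 0 - a 0) / (c 0 - a 0), ?_, ?_⟩
    · field_simp; ring
    · field_simp; linarith

theorem ori_trans {u v x y z : Pt} (huv : u ≠ v) (hx : ori u v x = 0) (hy : ori u v y = 0)
    (hz : ori u v z = 0) : ori x y z = 0 := by
  obtain ⟨r, r0, r1⟩ := ori_param huv (b := x) (by rw [ori_swap, hx, neg_zero])
  obtain ⟨s, s0, s1⟩ := ori_param huv (b := y) (by rw [ori_swap, hy, neg_zero])
  obtain ⟨t, t0, t1⟩ := ori_param huv (b := z) (by rw [ori_swap, hz, neg_zero])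
  unfold ori
  rw [r0, r1, s0, s1, t0, t1]; ring

theorem col_of_ori {s : Set Pt} (h : ∀ a ∈ s, ∀ b ∈ s, ∀ c ∈ s, ori a b c = 0) :
    Collinear ℝ s := by
  by_cases hs : s.Subsingleton
  · refine hs.induction_on (p := fun s => Collinear ℝ s) (collinear_empty ℝ Pt)
      (fun x => collinear_singleton ℝ x)
  · rw [Set.not_subsingleton_iff] at hs
    obtain ⟨u, hu, v, hv, huv⟩ := hs
    rw [collinear_iff_of_mem hu]
    refine ⟨v - u, fun p hp => ?_⟩
    obtain ⟨t, h0, h1⟩ := ori_param huv (h u hu p hp v hv)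
    refine ⟨t, pt_ext ?_ ?_⟩
    · simp [h0]; ring
    · simp [h1]; ring

theorem ori_of_col {s : Set Pt} (h : Collinear ℝ s) {a b c : Pt} (ha : a ∈ s) (hb : b ∈ s)
    (hc : c ∈ s) : ori a b c = 0 := by
  rw [collinear_iff_of_mem ha] at h
  obtain ⟨v, hv⟩ := h
  obtain ⟨r, rfl⟩ := hv b hb
  obtain ⟨t, rfl⟩ := hv c hc
  simp [ori]; ring

theorem genPos_ori {P : Finset Pt} (h : GenPos P) {a b c : Pt} (ha : a ∈ P) (hb : b ∈ P)
    (hc : c ∈ P) (hab : a ≠ b) (hbc : b ≠ c) (hac : a ≠ c) : ori a b c ≠ 0 := by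
  intro h0
  refine h {a, b, c} ?_ (Finset.card_eq_three.2 ⟨a, b, c, hab, hac, hbc, rfl⟩) ?_
  · intro x hx
    simp only [Finset.mem_insert, Finset.mem_singleton] at hx
    rcases hx with rfl | rfl | rfl <;> assumption
  · apply col_of_ori
    have key : ∀ x ∈ (({a, b, c} : Finset Pt) : Set Pt), ori a b x = 0 := by
      intro x hx
      simp only [Finset.coe_insert, Finset.coe_singleton, Set.mem_insert_iff,
        Set.mem_singleton_iff] at hx
      rcases hx with rfl | rfl | rfl
      · exact ori_self3 _ _
      · exact ori_self2 _ _
      · exact h0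
    intro x hx y hy z hz
    exact ori_trans hab (key x hx) (key y hy) (key z hz)

theorem genPos_of_ori {P : Finset Pt} (h : ∀ a ∈ P, ∀ b ∈ P, ∀ c ∈ P, a ≠ b → b ≠ c → a ≠ c →
    ori a b c ≠ 0) : GenPos P := by
  intro S hS hc hcol
  obtain ⟨a, b, c, hab, hac, hbc, rfl⟩ := Finset.card_eq_three.1 hc
  exact h a (hS (by simp)) b (hS (by simp)) c (hS (by simp)) hab hbc hac
    (ori_of_col hcol (by simp) (by simp) (by simp))

theorem convex_half (a b : Pt) : Convex ℝ {x : Pt | 0 ≤ ori a b x} := by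
  intro x hx y hy s t hs ht hst
  simp only [Set.mem_ofPred_eq] at *
  have : ori a b (s • x + t • y) = s * ori a b x + t * ori a b y := by
    have hs' : s = 1 - t := by linarith
    subst hs'
    simp [ori]; ring
  rw [this]; positivity

/-- positively oriented sequence -/
def PosSeq (n : ℕ) (q : ℕ → Pt) : Prop :=
  ∀ a b c, a < b → b < c → c < n → 0 < ori (q a) (q b) (q c)

theorem posSeq_ne {n : ℕ} (hn : 3 ≤ n) {q : ℕ → Pt} (h : PosSeq n q) {a b : ℕ} (hab : a < b)
    (hb : b < n) : q a ≠ q b := by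
  intro he
  by_cases h1 : b + 1 < n
  · have := h a b (b+1) hab (by omega) h1
    rw [he, ori_self1] at this; exact lt_irrefl _ this
  · by_cases h2 : 0 < a
    · have := h 0 a b h2 hab hb
      rw [he, ori_self2] at this; exact lt_irrefl _ this
    · have := h a (a+1) b (by omega) (by omega) hb
      rw [he, ori_self3] at this; exact lt_irrefl _ this

theorem posSeq_inj {n : ℕ} (hn : 3 ≤ n) {q : ℕ → Pt} (h : PosSeq n q) :
    Set.InjOn q (Finset.range n : Set ℕ) := by
  intro a ha b hb he
  simp only [Finset.coe_range, Set.mem_Iio] at ha hb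
  rcases lt_trichotomy a b with h1 | h1 | h1
  · exact absurd he (posSeq_ne hn h h1 hb)
  · exact h1
  · exact absurd he.symm (posSeq_ne hn h h1 ha)

theorem strict_of_sep {S : Finset Pt} {v : Pt} (hv : v ∈ S) (x y : Pt)
    (h1 : ori x y v < 0) (h2 : ∀ w ∈ S, w ≠ v → 0 ≤ ori x y w) : IsCornerOf S v := by
  intro he
  have hmem : v ∈ convexHull ℝ (S : Set Pt) := subset_convexHull ℝ _ hv
  rw [← he] at hmem
  have := convexHull_min (s := (S : Set Pt) \ {v}) (fun w hw => h2 w hw.1 hw.2) (convex_half x y) hmem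
  exact absurd this (not_le.2 h1)

theorem posSeq_strict {n : ℕ} (hn : 3 ≤ n) {q : ℕ → Pt} (h : PosSeq n q) :
    StrictConvexPos ((Finset.range n).image q) := by
  intro v hv
  have hv0 := hv
  obtain ⟨a, ha, rfl⟩ := Finset.mem_image.1 hv
  rw [Finset.mem_range] at ha
  have key : ∀ i j : ℕ, ori (q i) (q j) (q a) < 0 → (∀ b < n, b ≠ a → b ≠ i → b ≠ j →
      0 < ori (q i) (q j) (q b)) → IsCornerOf ((Finset.range n).image q) (q a) := by
    intro i j h1 h2
    refine strict_of_sep hv (q i) (q j) h1 ?_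
    intro w hw hne
    obtain ⟨b, hb, rfl⟩ := Finset.mem_image.1 hw
    by_cases hi : b = i
    · rw [hi, ori_self3]
    by_cases hj : b = j
    · rw [hj, ori_self2]
    exact (h2 b (Finset.mem_range.1 hb) (fun h => hne (by rw [h])) hi hj).le
  by_cases h0 : a = 0
  · subst h0
    refine key (n-1) 1 ?_ ?_
    · have := h 0 1 (n-1) (by omega) (by omega) (by omega)
      rw [ori_rot] at this
      rw [ori_swap]
      linarith
    · intro b hb h1 h2 h3
      rw [← ori_rot]
      exact h 1 b (n-1) (by omega) (by omega) (by omega)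
  by_cases h1 : a = n - 1
  · refine key (n-2) 0 ?_ ?_
    · have := h 0 (n-2) a (by omega) (by omega) (by omega)
      rw [← ori_rot, ori_swap]
      linarith
    · intro b hb h1 h2 h3
      rw [← ori_rot]
      exact h 0 b (n-2) (by omega) (by omega) (by omega)
  · refine key (a-1) (a+1) ?_ ?_
    · have := h (a-1) a (a+1) (by omega) (by omega) (by omega)
      rw [ori_swap]
      linarith
    · intro b hb h1 h2 h3
      rcases lt_or_gt_of_ne h1 with h4 | h4
      · rw [ori_rot]
        exact h b (a-1) (a+1) (by omega) (by omega) (by omega)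
      · exact h (a-1) (a+1) b (by omega) (by omega) (by omega)

theorem frontier_of_sep {S : Finset Pt} {v c : Pt} (hv : v ∈ S) (x y : Pt)
    (h0 : ori x y v = 0) (h1 : 0 < ori x y c) (h2 : ∀ w ∈ S, 0 ≤ ori x y w) :
    v ∈ frontier (convexHull ℝ (S : Set Pt)) := by
  have hmem : v ∈ convexHull ℝ (S : Set Pt) := subset_convexHull ℝ _ hv
  refine ⟨subset_closure hmem, fun hi => ?_⟩
  have hcont : Filter.Tendsto (fun δ : ℝ => v - δ • (c - v)) (nhds 0) (nhds v) := by
    have : Continuous (fun δ : ℝ => v - δ • (c - v)) := by fun_prop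
    simpa using this.tendsto 0
  have hev := hcont.eventually (mem_interior_iff_mem_nhds.1 hi)
  obtain ⟨δ, hδ, hpos⟩ := ((hev.filter_mono nhdsWithin_le_nhds).and
    (self_mem_nhdsWithin : Set.Ioi (0:ℝ) ∈ nhdsWithin 0 (Set.Ioi 0))).exists
  have := convexHull_min (s := (S : Set Pt)) (fun w hw => h2 w hw) (convex_half x y) hδ
  replace this : 0 ≤ ori x y (v - δ • (c - v)) := this
  have e : ori x y (v - δ • (c - v)) = (1 + δ) * ori x y v - δ * ori x y c := by
    simp [ori]; ring
  rw [e, h0] at this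
  have hp : 0 < δ := hpos
  nlinarith [mul_pos hp h1]

theorem posSeq_convex {n : ℕ} (hn : 3 ≤ n) {q : ℕ → Pt} (h : PosSeq n q) :
    ConvexPos ((Finset.range n).image q) := by
  intro v hv
  obtain ⟨a, ha, rfl⟩ := Finset.mem_image.1 hv
  rw [Finset.mem_range] at ha
  have key : ∀ j c : ℕ, j < n → c < n → c ≠ a → c ≠ j → (∀ b < n, b ≠ a → b ≠ j →
      0 < ori (q a) (q j) (q b)) → (q a) ∈ frontier (convexHull ℝ
        (((Finset.range n).image q : Finset Pt) : Set Pt)) := by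
    intro j c hj hc hca hcj h2
    refine frontier_of_sep hv (q a) (q j) (ori_self3 _ _) (h2 c hc hca hcj) ?_
    intro w hw
    obtain ⟨b, hb, rfl⟩ := Finset.mem_image.1 hw
    by_cases hi : b = a
    · rw [hi, ori_self3]
    by_cases hj : b = j
    · rw [hj, ori_self2]
    exact (h2 b (Finset.mem_range.1 hb) hi hj).le
  by_cases h1 : a = n - 1
  · refine key 0 1 (by omega) (by omega) (by omega) (by omega) ?_
    intro b hb h1 h2
    rw [← ori_rot]
    exact h 0 b a (by omega) (by omega) (by omega)
  · refine key (a+1) (if a = 0 then 2 else 0) (by omega) (by split_ifs <;> omega)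
      (by split_ifs <;> omega) (by split_ifs <;> omega) ?_
    intro b hb h1 h2
    rcases lt_or_gt_of_ne h1 with h4 | h4
    · rw [ori_rot]
      exact h b a (a+1) (by omega) (by omega) (by omega)
    · exact h a (a+1) b (by omega) (by omega) (by omega)

/-- partial choice of `2 s` indices -/
def Good (F : ℕ → ℕ → Prop) (s lo hi : ℕ) : Prop :=
  ∃ f : ℕ → ℕ, (∀ t, t + 1 < 2 * s → f t < f (t+1)) ∧
    (∀ t, t + 2 < 2 * s → ¬ F (f t) (f (t+2))) ∧ lo ≤ f 0 ∧ f (2 * s - 1) ≤ hi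

theorem good_step {F : ℕ → ℕ → Prop} {l : ℕ} (hl : 3 ≤ l)
    (len : ∀ a c, F a c → c + 2 ≤ a + l) {s lo hi : ℕ} (hs : 1 ≤ s) (h : Good F s lo hi) :
    Good F (s+1) lo (hi + (l-1)) := by
  obtain ⟨f, h1, h2, h3, h4⟩ := h
  obtain ⟨r, rfl⟩ : ∃ r, s = r + 1 := ⟨s - 1, by omega⟩
  have e1 : 2 * (r+1) - 1 = 2 * r + 1 := by omega
  rw [e1] at h4
  refine ⟨fun t => if t < 2 * r + 2 then f t else if t = 2 * r + 2 then f (2*r+1) + (l-2)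
    else f (2*r+1) + (l-1), ?_, ?_, ?_, ?_⟩
  · intro t ht
    rcases lt_trichotomy (t+1) (2*r+2) with h | h | h
    · simp only [h, (by omega : t < 2*r+2), if_true]; exact h1 t (by omega)
    · obtain rfl : t = 2*r+1 := by omega
      simp; omega
    · obtain rfl : t = 2*r+2 := by omega
      simp; omega
  · intro t ht
    rcases lt_trichotomy (t+2) (2*r+2) with h | h | h
    · simp only [h, (by omega : t < 2*r+2), if_true]; exact h2 t (by omega)
    · obtain rfl : t = 2*r := by omega
      simp only [lt_irrefl, if_false, if_true, (by omega : 2*r < 2*r+2)]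
      intro hF
      have := len _ _ hF
      have := h1 (2*r) (by omega)
      omega
    · obtain rfl : t = 2*r+1 := by omega
      intro hF
      simp only [if_true, (by omega : 2*r+1 < 2*r+2)] at hF
      rw [if_neg (by omega), if_neg (by omega)] at hF
      have := len _ _ hF
      omega
  · simpa using h3
  · have : 2 * (r+1+1) - 1 = 2*r+3 := by omega
    simp [this]; omega

theorem good_steps {F : ℕ → ℕ → Prop} {l : ℕ} (hl : 3 ≤ l)
    (len : ∀ a c, F a c → c + 2 ≤ a + l) {s lo hi : ℕ} (hs : 1 ≤ s) (h : Good F s lo hi) (n : ℕ) :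
    Good F (s+n) lo (hi + n * (l-1)) := by
  induction n with
  | zero => simpa using h
  | succ n ih =>
    have := good_step hl len (by omega) ih
    rw [Nat.succ_mul, ← Nat.add_assoc hi]
    exact this

theorem comb {F : ℕ → ℕ → Prop} {l m j : ℕ} (hl : 3 ≤ l) (hj : 2 ≤ j)
    (hm : m = (j-1) * (l-1) + 2)
    (mono : ∀ a c a' c', a ≤ a' → c' ≤ c → F a c → F a' c')
    (merge : ∀ a b c d, a ≤ b → b < c → c ≤ d → F a c → F b d → F a d)
    (len : ∀ a c, F a c → c + 2 ≤ a + l)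
    (per : ∀ a c, F (a+m) (c+m) → F a c) :
    ∃ f : ℕ → ℕ, (∀ t, t + 1 < 2 * j → f t < f (t+1)) ∧
      (∀ t, t + 2 < 2 * j → ¬ F (f t) (f (t+2))) ∧ f (2*j-1) < f 0 + m ∧
      ¬ F (f (2*j-2)) (f 0 + m) ∧ ¬ F (f (2*j-1)) (f 1 + m) := by
  -- closing
  have closeB : ∀ b, ¬ F b (b+2) → Good F j (b+2) (b+m) → ∃ f : ℕ → ℕ,
      (∀ t, t + 1 < 2 * j → f t < f (t+1)) ∧
      (∀ t, t + 2 < 2 * j → ¬ F (f t) (f (t+2))) ∧ f (2*j-1) < f 0 + m ∧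
      ¬ F (f (2*j-2)) (f 0 + m) ∧ ¬ F (f (2*j-1)) (f 1 + m) := by
    rintro b hb ⟨f, h1, h2, h3, h4⟩
    have e1 := h1 (2*j-2) (by omega)
    rw [(by omega : 2*j-2+1 = 2*j-1)] at e1
    have e2 := h1 0 (by omega)
    rw [zero_add] at e2
    refine ⟨f, h1, h2, by omega, ?_, ?_⟩
    · intro hF
      exact hb (per _ _ (mono _ _ _ _ (by omega) (by omega) hF))
    · intro hF
      exact hb (per _ _ (mono _ _ _ _ (by omega) (by omega) hF))
  by_cases hA : ∃ b, ¬ F b (b+2) ∧ ¬ F (b+1) (b+3)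
  · obtain ⟨b, hb, hb'⟩ := hA
    have g1 : Good F 1 (b+2) (b+3) := ⟨fun t => b+2+t, fun t _ => by simp, fun t ht => by omega,
      by simp, by simp⟩
    obtain ⟨f, h1, h2, h3, h4⟩ := good_steps hl len le_rfl g1 (j-1)
    rw [(by omega : 1 + (j-1) = j)] at h1 h2 h4
    have e1 := h1 (2*j-2) (by omega)
    rw [(by omega : 2*j-2+1 = 2*j-1)] at e1
    have e2 := h1 0 (by omega)
    rw [zero_add] at e2
    refine ⟨f, h1, h2, by omega, ?_, ?_⟩
    · intro hF
      exact hb (per _ _ (mono _ _ _ _ (by omega) (by omega) hF))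
    · intro hF
      exact hb' (per _ _ (mono _ _ _ _ (by omega) (by omega) hF))
  push Not at hA
  -- existence of a corner
  have hcor : ∃ b, ¬ F b (b+2) := by
    by_contra hno
    push Not at hno
    have : ∀ n, F 0 (n+2) := by
      intro n
      induction n with
      | zero => exact hno 0
      | succ n ih => exact merge 0 (n+1) (n+2) (n+3) (by omega) (by omega) (by omega) ih (hno (n+1))
    have := len _ _ (this l)
    omega
  have mm : (j-1) * (l-1) = (j-2) * (l-1) + (l-1) := by
    obtain ⟨i, rfl⟩ : ∃ i, j = i + 2 := ⟨j-2, by omega⟩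
    rw [(by omega : i+2-1 = i+1), (by omega : i+2-2 = i), Nat.succ_mul]
  by_cases hB : ∃ b, ¬ F b (b+2) ∧ ¬ F (b+3) (b+1+l)
  · obtain ⟨b, hb, hb'⟩ := hB
    have c1 := hA b hb
    have l4 := len _ _ c1
    have c2 : ¬ F (b+2) (b+l) := by
      intro hF
      have := len _ _ (merge (b+1) (b+2) (b+3) (b+l) (by omega) (by omega) (by omega) c1 hF)
      omega
    have g1 : Good F 2 (b+2) (b+1+l) := by
      refine ⟨fun t => if t < 2 then b+2+t else b+l+t-2, ?_, ?_, ?_, ?_⟩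
      · intro t ht
        have : t = 0 ∨ t = 1 ∨ t = 2 := by omega
        rcases this with rfl | rfl | rfl
        · simp
        · simp
          by_contra hcon
          have : b + l = b + 3 ∨ b + l = b + 4 := by omega
          have h5 : l = 4 ∨ l = 3 := by omega
          rcases h5 with rfl | rfl <;> omega
        · simp
      · intro t ht
        have : t = 0 ∨ t = 1 := by omega
        rcases this with rfl | rfl
        · simpa using c2
        · have : b + l + 3 - 2 = b+1+l := by omega
          simpa [this] using hb'
      · simp
      · simp
    have g2 := good_steps hl len (by omega) g1 (j-2)
    rw [(by omega : 2 + (j-2) = j), (by omega : b + 1 + l + (j-2) * (l-1) = b + m)] at g2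
    exact closeB b hb g2
  push Not at hB
  obtain ⟨b, hb⟩ := hcor
  -- no three-flat after a corner
  have next : ∀ b, ¬ F b (b+2) → ¬ F (b+2) (b+4) := by
    intro b hb hF
    have h1 := hA b hb
    have h2 := hB b hb
    have := len _ _ h1
    have h4 := len _ _ (merge (b+1) (b+2) (b+3) (b+4) (by omega) (by omega) (by omega) h1 hF)
    have h3 := len _ _ (merge (b+1) (b+3) (b+4) (b+1+l) (by omega) (by omega) (by omega)
      (merge (b+1) (b+2) (b+3) (b+4) (by omega) (by omega) (by omega) h1 hF) h2)
    omega
  have n1 := next b hb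
  have n2 := next (b+2) n1
  have n3 := next (b+2+2) n2
  have l4 : l = 4 := by
    have h1 := len _ _ (hA b hb)
    by_contra hne
    have := len _ _ (merge (b+3) (b+5) (b+1+l) (b+2+1+l) (by omega) (by omega) (by omega) (hB b hb) (hB (b+2) n1))
    omega
  subst l4
  by_cases j2 : j = 2
  · subst j2
    have h5 := hA (b+4) n2
    have : m = 5 := by omega
    subst this
    exact absurd (per _ _ h5) hb
  · have g1 : Good F 3 (b+2) (b+8) := by
      refine ⟨fun t => if t < 3 then b+2+t else b+3+t, ?_, ?_, ?_, ?_⟩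
      · intro t ht
        simp only; split_ifs <;> omega
      · intro t ht
        have : t = 0 ∨ t = 1 ∨ t = 2 ∨ t = 3 := by omega
        rcases this with rfl | rfl | rfl | rfl
        · simpa using n1
        · intro hF
          exact n2 (mono _ _ _ _ (by simp) (by simp) hF)
        · intro hF
          exact n2 (mono _ _ _ _ (by simp) (by simp) hF)
        · intro hF
          exact n3 (mono _ _ _ _ (by simp) (by simp) hF)
      · simp
      · simp
    have g2 := good_steps hl len (by omega) g1 (j-3)
    rw [(by omega : 3 + (j-3) = j), (by omega : b + 8 + (j-3) * (4-1) = b + m)] at g2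
    exact closeB b hb g2

/-- all points with index in `[a, c]` are collinear -/
def Flat (p : ℕ → Pt) (a c : ℕ) : Prop :=
  ∀ x y z, a ≤ x → x ≤ c → a ≤ y → y ≤ c → a ≤ z → z ≤ c → ori (p x) (p y) (p z) = 0

theorem flat_of_base {p : ℕ → Pt} {a c : ℕ} {u v : Pt} (huv : u ≠ v)
    (h : ∀ x, a ≤ x → x ≤ c → ori u v (p x) = 0) : Flat p a c := by
  intro x y z h1 h2 h3 h4 h5 h6
  exact ori_trans huv (h x h1 h2) (h y h3 h4) (h z h5 h6)

theorem flat_of_between {p : ℕ → Pt} {m : ℕ}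
    (hw : ∀ a b c, a < b → b < c → c < a + m → 0 ≤ ori (p a) (p b) (p c))
    {x y z : ℕ} (hxy : x < y) (hyz : y < z) (hz : z < x + m) (hne : p x ≠ p z) {t : ℝ}
    (t0 : 0 < t) (t1 : t < 1) (e0 : p y 0 = p x 0 + t * (p z 0 - p x 0))
    (e1 : p y 1 = p x 1 + t * (p z 1 - p x 1)) : Flat p x z := by
  refine flat_of_base hne ?_
  intro d h1 h2
  rcases eq_or_lt_of_le h1 with rfl | h1
  · exact ori_self3 _ _
  rcases eq_or_lt_of_le h2 with rfl | h2
  · exact ori_self2 _ _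
  rcases lt_trichotomy d y with h3 | rfl | h3
  · have a1 := hw x d y h1 h3 (by omega)
    have a2 := hw d y z h3 hyz (by omega)
    have b1 : ori (p x) (p d) (p y) = - (t * ori (p x) (p z) (p d)) := by
      unfold ori; rw [e0, e1]; ring
    have b2 : ori (p d) (p y) (p z) = (1 - t) * ori (p x) (p z) (p d) := by
      unfold ori; rw [e0, e1]; ring
    rw [b1] at a1
    rw [b2] at a2
    have c1 : 0 ≤ ori (p x) (p z) (p d) := nonneg_of_mul_nonneg_right a2 (by linarith)
    have c2 : 0 ≤ - ori (p x) (p z) (p d) := nonneg_of_mul_nonneg_right (a := t) (by linarith) t0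
    linarith
  · unfold ori; rw [e0, e1]; ring
  · have a1 := hw x y d hxy h3 (by omega)
    have a2 := hw y d z h3 h2 (by omega)
    have b1 : ori (p x) (p y) (p d) = (t * ori (p x) (p z) (p d)) := by
      unfold ori; rw [e0, e1]; ring
    have b2 : ori (p y) (p d) (p z) = (1 - t) * (- ori (p x) (p z) (p d)) := by
      unfold ori; rw [e0, e1]; ring
    rw [b1] at a1
    rw [b2] at a2
    have c1 : 0 ≤ - ori (p x) (p z) (p d) := nonneg_of_mul_nonneg_right a2 (by linarith)
    have c2 : 0 ≤ ori (p x) (p z) (p d) := nonneg_of_mul_nonneg_right a1 t0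
    linarith

theorem flat_cases {p : ℕ → Pt} {m : ℕ} (hper : ∀ n, p (n + m) = p n)
    (hinj : ∀ a b, a < b → b < a + m → p a ≠ p b)
    (hw : ∀ a b c, a < b → b < c → c < a + m → 0 ≤ ori (p a) (p b) (p c))
    {x y z : ℕ} (hxy : x < y) (hyz : y < z) (hz : z < x + m) (h0 : ori (p x) (p y) (p z) = 0) :
    Flat p x z ∨ Flat p y (x + m) ∨ Flat p z (y + m) := by
  have hxz := hinj x z (by omega) (by omega)
  have hxy' := hinj x y (by omega) (by omega)
  have hyz' := hinj y z (by omega) (by omega)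
  obtain ⟨t, e0, e1⟩ := ori_param hxz h0
  have t0 : t ≠ 0 := by
    rintro rfl
    exact hxy' (pt_ext (by linarith) (by linarith))
  have t1 : t ≠ 1 := by
    rintro rfl
    exact hyz' (pt_ext (by linarith) (by linarith))
  rcases lt_or_gt_of_ne t0 with h | h
  · -- x between y and z : window z .. y + m
    right; right
    have h1 : 1 - t > 0 := by linarith
    refine flat_of_between hw (x := z) (y := x + m) (z := y + m) (by omega) (by omega) (by omega)
      (by rw [hper]; exact hyz'.symm) (t := 1 / (1 - t)) (by positivity)
      (by rw [div_lt_one h1]; linarith) ?_ ?_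
    · rw [hper, hper, e0]; field_simp; ring
    · rw [hper, hper, e1]; field_simp; ring
  · rcases lt_or_gt_of_ne t1 with h' | h'
    · left
      exact flat_of_between hw hxy hyz hz hxz h h' e0 e1
    · right; left
      refine flat_of_between hw (x := y) (y := z) (z := x + m) (by omega) (by omega) (by omega)
        (by rw [hper]; exact hxy'.symm) (t := (t - 1) / t)
        (div_pos (by linarith) h)
        (by rw [div_lt_one h]; linarith) ?_ ?_
      · rw [hper, e0]; field_simp; ring
      · rw [hper, e1]; field_simp; ring

theorem weak_main {q : ℕ → Pt} {l m j : ℕ} (hl : 3 ≤ l) (hj : 2 ≤ j)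
    (hm : m = (j-1) * (l-1) + 2)
    (hinj0 : ∀ a b, a < b → b < m → q a ≠ q b)
    (hw0 : ∀ a b c, a < b → b < c → c < m → 0 ≤ ori (q a) (q b) (q c))
    (hcol : ∀ T ⊆ Finset.range m, T.card = l → ∃ x ∈ T, ∃ y ∈ T, ∃ z ∈ T,
      ori (q x) (q y) (q z) ≠ 0) :
    ∃ g : ℕ → ℕ, (∀ t, g t < m) ∧ PosSeq (2 * j) (fun t => q (g t)) := by
  have hmpos : 0 < m := by omega
  have hlm : l < m := by
    obtain ⟨i, rfl⟩ : ∃ i, j = i + 2 := ⟨j-2, by omega⟩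
    have : (i + 2 - 1) * (l-1) = i * (l-1) + (l-1) := by
      rw [(by omega : i+2-1 = i+1), Nat.succ_mul]
    omega
  obtain ⟨p, hp⟩ : ∃ p : ℕ → Pt, p = fun n => q (n % m) := ⟨_, rfl⟩
  have hper : ∀ n, p (n + m) = p n := by intro n; simp [hp]
  have hlow : ∀ n, n < m → p n = q n := by intro n hn; simp [hp, Nat.mod_eq_of_lt hn]
  have hper' : ∀ n, m ≤ n → p n = p (n - m) := by
    intro n hn
    rw [← hper (n-m)]; congr 1; omega
  have hinj : ∀ a b, a < b → b < a + m → p a ≠ p b := by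
    intro a
    induction a using Nat.strong_induction_on with
    | _ a ih =>
      intro b h1 h2
      by_cases ha : a < m
      · by_cases hb : b < m
        · rw [hlow a ha, hlow b hb]; exact hinj0 a b h1 hb
        · rw [hper' b (by omega), hlow a ha, hlow (b-m) (by omega)]
          exact (hinj0 (b-m) a (by omega) ha).symm
      · rw [hper' a (by omega), hper' b (by omega)]
        exact ih (a-m) (by omega) (b-m) (by omega) (by omega)
  have hw : ∀ a b c, a < b → b < c → c < a + m → 0 ≤ ori (p a) (p b) (p c) := by
    intro a
    induction a using Nat.strong_induction_on with
    | _ a ih =>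
      intro b c h1 h2 h3
      by_cases ha : a < m
      · by_cases hb : b < m
        · by_cases hc : c < m
          · rw [hlow a ha, hlow b hb, hlow c hc]; exact hw0 a b c h1 h2 hc
          · rw [hper' c (by omega), hlow a ha, hlow b hb, hlow (c-m) (by omega), ori_rot]
            exact hw0 (c-m) a b (by omega) h1 hb
        · rw [hper' b (by omega), hper' c (by omega), hlow a ha, hlow (b-m) (by omega),
            hlow (c-m) (by omega), ← ori_rot]
          exact hw0 (b-m) (c-m) a (by omega) (by omega) ha
      · rw [hper' a (by omega), hper' b (by omega), hper' c (by omega)]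
        exact ih (a-m) (by omega) (b-m) (c-m) (by omega) (by omega) (by omega)
  have mono : ∀ a c a' c', a ≤ a' → c' ≤ c → Flat p a c → Flat p a' c' := by
    intro a c a' c' h1 h2 h x y z _ _ _ _ _ _
    exact h x y z (by omega) (by omega) (by omega) (by omega) (by omega) (by omega)
  have merge : ∀ a b c d, a ≤ b → b < c → c ≤ d → Flat p a c → Flat p b d → Flat p a d := by
    intro a b c d h1 h2 h3 hF hG
    refine flat_of_base (hinj b (b+1) (by omega) (by omega)) ?_
    intro x hx hx'
    by_cases hxb : b ≤ x
    · exact hG _ _ _ (by omega) (by omega) (by omega) (by omega) hxb hx'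
    · exact hF _ _ _ (by omega) (by omega) (by omega) (by omega) hx (by omega)
  have len : ∀ a c, Flat p a c → c + 2 ≤ a + l := by
    intro a c hF
    by_contra hcon
    have hinjT : Set.InjOn (fun i => (a + i) % m) (Finset.range l : Set ℕ) := by
      have key : ∀ i i', i < i' → i' < l → (a + i) % m ≠ (a + i') % m := by
        intro i i' h1 h2 he
        refine hinj (a+i) (a+i') (by omega) (by omega) ?_
        simp only [hp, he]
      intro i hi i' hi' he
      simp only [Finset.coe_range, Set.mem_Iio] at hi hi'
      rcases lt_trichotomy i i' with h | h | h
      · exact absurd he (key _ _ h hi')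
      · exact h
      · exact absurd he.symm (key _ _ h hi)
    obtain ⟨x, hx, y, hy, z, hz, hne⟩ := hcol ((Finset.range l).image (fun i => (a + i) % m))
      (by
        intro x hx
        obtain ⟨i, _, rfl⟩ := Finset.mem_image.1 hx
        exact Finset.mem_range.2 (Nat.mod_lt _ hmpos))
      (by rw [Finset.card_image_of_injOn hinjT, Finset.card_range])
    obtain ⟨i1, h1, rfl⟩ := Finset.mem_image.1 hx
    obtain ⟨i2, h2, rfl⟩ := Finset.mem_image.1 hy
    obtain ⟨i3, h3, rfl⟩ := Finset.mem_image.1 hz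
    rw [Finset.mem_range] at h1 h2 h3
    apply hne
    have := hF (a+i1) (a+i2) (a+i3) (by omega) (by omega) (by omega) (by omega) (by omega) (by omega)
    simpa [hp] using this
  have per : ∀ a c, Flat p (a+m) (c+m) → Flat p a c := by
    intro a c h x y z _ _ _ _ _ _
    rw [← hper x, ← hper y, ← hper z]
    exact h _ _ _ (by omega) (by omega) (by omega) (by omega) (by omega) (by omega)
  obtain ⟨f, h1, h2, h3, h4, h5⟩ := comb hl hj hm mono merge len per
  have hmon : ∀ a b, a ≤ b → b < 2 * j → f a ≤ f b := by
    intro a b hab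
    induction b, hab using Nat.le_induction with
    | base => intro _; exact le_rfl
    | succ b _ ih =>
      intro hb
      exact (ih (by omega)).trans (h1 b hb).le
  have hsm : ∀ a b, a < b → b < 2 * j → f a < f b := by
    intro a b hab hb
    exact (h1 a (by omega)).trans_le (hmon (a+1) b hab hb)
  refine ⟨fun t => f t % m, fun t => Nat.mod_lt _ hmpos, ?_⟩
  intro a b c hab hbc hc
  have hfl := hmon c (2*j-1) (by omega) (by omega)
  have hfa := hmon 0 a (by omega) (by omega)
  have s1 := hsm a b hab (by omega)
  have s2 := hsm b c hbc hc
  have hge := hw (f a) (f b) (f c) s1 s2 (by omega)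
  have hgoal : 0 < ori (p (f a)) (p (f b)) (p (f c)) := by
    rcases hge.lt_or_eq with h | h
    · exact h
    exfalso
    rcases flat_cases hper hinj hw s1 s2 (by omega) h.symm with hF | hF | hF
    · exact h2 a (by omega) (mono _ _ _ _ le_rfl (hmon (a+2) c (by omega) hc) hF)
    · by_cases hb2 : b + 2 < 2 * j
      · have := hmon (b+2) (2*j-1) (by omega) (by omega)
        exact h2 b hb2 (mono _ _ _ _ le_rfl (by omega) hF)
      · obtain rfl : b = 2 * j - 2 := by omega
        exact h4 (mono _ _ _ _ le_rfl (by omega) hF)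
    · have hfb := hmon 1 b (by omega) (by omega)
      by_cases hb2 : c + 2 < 2 * j
      · have := hmon (c+2) (2*j-1) (by omega) (by omega)
        exact h2 c hb2 (mono _ _ _ _ le_rfl (by omega) hF)
      · by_cases hc2 : c = 2 * j - 1
        · subst hc2
          exact h5 (mono _ _ _ _ le_rfl (by omega) hF)
        · obtain rfl : c = 2 * j - 2 := by omega
          exact h4 (mono _ _ _ _ le_rfl (by omega) hF)
  simpa [hp] using hgoal

theorem sort_lemma {α : Type*} (T : Finset α) (hne : T.Nonempty) (g : α → ℝ) (hg : Set.InjOn g (T : Set α)) :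
    ∃ e : ℕ → α, (∀ i, e i ∈ T) ∧ ∀ i j, i < j → j < T.card → g (e i) < g (e j) := by
  have hc : (T.image g).card = T.card := Finset.card_image_of_injOn hg
  have hpos : 0 < T.card := hne.card_pos
  have h1 : ∀ i : Fin T.card, ∃ x ∈ T, g x = (T.image g).orderEmbOfFin hc i := fun i =>
    Finset.mem_image.1 ((T.image g).orderEmbOfFin_mem hc i)
  choose e he1 he2 using h1
  refine ⟨fun i => if h : i < T.card then e ⟨i, h⟩ else e ⟨0, hpos⟩, ?_, ?_⟩
  · intro i; dsimp only; split_ifs <;> exact he1 _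
  · intro i j hij hj
    simp only [hj, hij.trans hj, dif_pos, he2]
    exact ((T.image g).orderEmbOfFin hc).strictMono hij

theorem exists_phi (S : Finset Pt) : ∃ ε : ℝ, ∀ a ∈ S, ∀ b ∈ S, a ≠ b →
    a 0 + ε * a 1 ≠ b 0 + ε * b 1 := by
  obtain ⟨ε, hε⟩ := Infinite.exists_notMem_finset
    ((S ×ˢ S).image (fun x : Pt × Pt => - (x.1 0 - x.2 0) / (x.1 1 - x.2 1)))
  refine ⟨ε, fun a ha b hb hab he => ?_⟩
  by_cases h1 : a 1 - b 1 = 0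
  · have : a 1 = b 1 := by linarith
    rw [this] at he
    exact hab (pt_ext (by linarith) this)
  · apply hε
    refine Finset.mem_image.2 ⟨(a, b), Finset.mem_product.2 ⟨ha, hb⟩, ?_⟩
    rw [div_eq_iff h1]
    linarith

theorem tri_interior {S : Set Pt} {x y z b : Pt} (hx : x ∈ S) (hy : y ∈ S) (hz : z ∈ S)
    (h1 : 0 < ori x y b) (h2 : 0 < ori y z b) (h3 : 0 < ori z x b) :
    b ∉ frontier (convexHull ℝ S) := by
  have hsum : ∀ w : Pt, ori x y w + ori y z w + ori z x w = ori x y z := by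
    intro w; unfold ori; ring
  have hD : 0 < ori x y z := by rw [← hsum b]; positivity
  intro hf
  apply hf.2
  rw [mem_interior]
  refine ⟨{w | 0 < ori x y w ∧ 0 < ori y z w ∧ 0 < ori z x w}, ?_, ?_, h1, h2, h3⟩
  · rintro w ⟨w1, w2, w3⟩
    have hw : w = (ori y z w / ori x y z) • x + (ori z x w / ori x y z) • y +
        (ori x y w / ori x y z) • z := by
      have hne := hD.ne'
      apply pt_ext
      · simp only [PiLp.add_apply, PiLp.smul_apply, smul_eq_mul]
        field_simp
        unfold ori; ring
      · simp only [PiLp.add_apply, PiLp.smul_apply, smul_eq_mul]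
        field_simp
        unfold ori; ring
    rw [hw]
    refine (convex_convexHull ℝ S).sum_mem (t := (Finset.univ : Finset (Fin 3)))
      (w := ![ori y z w / ori x y z, ori z x w / ori x y z, ori x y w / ori x y z])
      (z := ![x, y, z]) ?_ ?_ ?_ |> fun h => by simpa [Fin.sum_univ_three] using h
    · intro i _; fin_cases i <;> simp <;> positivity
    · simp [Fin.sum_univ_three]
      have hne := hD.ne'
      field_simp
      rw [← hsum w]; ring
    · intro i _; fin_cases i
      · exact subset_convexHull ℝ _ hx
      · exact subset_convexHull ℝ _ hy
      · exact subset_convexHull ℝ _ hz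
  · have hc : ∀ u v : Pt, Continuous (fun w : Pt => ori u v w) := by
      intro u v; unfold ori; fun_prop
    exact ((isOpen_lt continuous_const (hc x y)).inter
      ((isOpen_lt continuous_const (hc y z)).inter (isOpen_lt continuous_const (hc z x))))

theorem order_convex {S : Finset Pt} (hne : 2 ≤ S.card) (hg : GenPos S) (hc : ConvexPos S) :
    ∃ q : ℕ → Pt, (∀ i, q i ∈ S) ∧ PosSeq S.card q := by
  obtain ⟨ε, hε⟩ := exists_phi S
  have hne' : S.Nonempty := Finset.card_pos.1 (by omega)
  obtain ⟨o, ho, hmin⟩ := S.exists_min_image (fun a => a 0 + ε * a 1) hne'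
  have hT : (S.erase o).card = S.card - 1 := Finset.card_erase_of_mem ho
  have hφ : ∀ a ∈ S.erase o, 0 < (a 0 - o 0) + ε * (a 1 - o 1) := by
    intro a ha
    rw [Finset.mem_erase] at ha
    have h1 := hmin a ha.2
    have h2 := hε a ha.2 o ho ha.1
    have := lt_of_le_of_ne h1 h2.symm
    linarith
  have hkey : ∀ a ∈ S.erase o, ∀ b ∈ S.erase o,
      ((a 1 - o 1) / ((a 0 - o 0) + ε * (a 1 - o 1)) < (b 1 - o 1) / ((b 0 - o 0) + ε * (b 1 - o 1))
        → 0 < ori o a b) ∧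
      ((a 1 - o 1) / ((a 0 - o 0) + ε * (a 1 - o 1)) = (b 1 - o 1) / ((b 0 - o 0) + ε * (b 1 - o 1))
        → 0 = ori o a b) := by
    intro a ha b hb
    have h1 := hφ a ha
    have h2 := hφ b hb
    rw [div_lt_div_iff₀ h1 h2, div_eq_div_iff h1.ne' h2.ne']
    unfold ori
    constructor
    · intro h; linarith
    · intro h; linarith
  obtain ⟨e, he1, he2⟩ := sort_lemma (S.erase o) (Finset.card_pos.1 (by omega))
    (fun a => (a 1 - o 1) / ((a 0 - o 0) + ε * (a 1 - o 1))) (by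
      intro a ha b hb hab
      by_contra hne
      have ha' := Finset.mem_erase.1 (Finset.mem_coe.1 ha)
      have hb' := Finset.mem_erase.1 (Finset.mem_coe.1 hb)
      exact genPos_ori hg ho ha'.2 hb'.2 ha'.1.symm hne hb'.1.symm ((hkey a ha b hb).2 hab).symm)
  have hpo : ∀ i j, i < j → j < S.card - 1 → 0 < ori o (e i) (e j) := by
    intro i j hij hj
    exact (hkey _ (he1 i) _ (he1 j)).1 (he2 i j hij (by omega))
  refine ⟨fun n => if n = 0 then o else e (n-1), ?_, ?_⟩
  · intro i; dsimp only; split_ifs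
    · exact ho
    · exact (Finset.mem_erase.1 (he1 _)).2
  · intro a b c hab hbc hcn
    dsimp only
    rw [if_neg (by omega : b ≠ 0), if_neg (by omega : c ≠ 0)]
    have hbc' := hpo (b-1) (c-1) (by omega) (by omega)
    split_ifs with h0
    · exact hbc'
    · have hab' := hpo (a-1) (b-1) (by omega) (by omega)
      have hac' := hpo (a-1) (c-1) (by omega) (by omega)
      by_contra hcon
      have hA := Finset.mem_erase.1 (he1 (a-1))
      have hB := Finset.mem_erase.1 (he1 (b-1))
      have hC := Finset.mem_erase.1 (he1 (c-1))
      have n1 : e (a-1) ≠ e (b-1) := by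
        intro h; rw [h, ori_self2] at hab'; exact lt_irrefl _ hab'
      have n2 : e (b-1) ≠ e (c-1) := by
        intro h; rw [h, ori_self2] at hbc'; exact lt_irrefl _ hbc'
      have n3 : e (a-1) ≠ e (c-1) := by
        intro h; rw [h, ori_self2] at hac'; exact lt_irrefl _ hac'
      have hlt := lt_of_le_of_ne (not_lt.1 hcon) (genPos_ori hg hA.2 hB.2 hC.2 n1 n2 n3)
      refine tri_interior (S := (S : Set Pt)) (x := o) (y := e (a-1)) (z := e (c-1)) (b := e (b-1))
        ho hA.2 hC.2 hab' ?_ ?_ (hc _ hB.2)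
      · rw [ori_swap]; linarith
      · rw [← ori_rot]; exact hbc'

/-- a monochromatic set ending with `i < j` -/
def MonoEnd (U : ℕ → ℕ → ℕ → Prop) (n i j : ℕ) : Prop :=
  ∃ T : Finset ℕ, i ∈ T ∧ j ∈ T ∧ T.card = n + 2 ∧ (∀ t ∈ T, t ≤ i ∨ t = j) ∧
    ∀ a ∈ T, ∀ b ∈ T, ∀ c ∈ T, a < b → b < c → U a b c

theorem monoEnd_zero (U : ℕ → ℕ → ℕ → Prop) {i j : ℕ} (hij : i < j) : MonoEnd U 0 i j := by
  refine ⟨{i, j}, by simp, by simp, Finset.card_pair hij.ne, ?_, ?_⟩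
  · intro t ht; simp at ht; omega
  · intro a ha b hb c hc; simp at ha hb hc; omega

theorem monoEnd_step {U : ℕ → ℕ → ℕ → Prop} {N : ℕ}
    (htr : ∀ a b c d, a < b → b < c → c < d → d < N → U a b c → U b c d → U a b d ∧ U a c d)
    {n i j k : ℕ} (hij : i < j) (hjk : j < k) (hk : k < N) (h : MonoEnd U n i j) (hU : U i j k) :
    MonoEnd U (n+1) j k := by
  obtain ⟨T, hi, hj, hcard, hle, htri⟩ := h
  have hkT : k ∉ T := by
    intro hkT; have := hle k hkT; omega
  have hlt : ∀ t ∈ T, t ≤ j := by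
    intro t ht; have := hle t ht; omega
  have h1 : ∀ a ∈ T, a < j → U a j k := by
    intro a ha haj
    rcases eq_or_lt_of_le (by have := hle a ha; omega : a ≤ i) with rfl | hai
    · exact hU
    · exact (htr a i j k hai hij hjk hk (htri a ha i hi j hj hai hij) hU).2
  have h2 : ∀ a ∈ T, ∀ b ∈ T, a < b → U a b k := by
    intro a ha b hb hab
    rcases eq_or_lt_of_le (hlt b hb) with rfl | hbj
    · exact h1 a ha hab
    · exact (htr a b j k hab hbj hjk hk (htri a ha b hb j hj hab hbj) (h1 b hb hbj)).1
  refine ⟨insert k T, by simp [hj], by simp, ?_, ?_, ?_⟩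
  · rw [Finset.card_insert_of_notMem hkT, hcard]
  · intro t ht
    rcases Finset.mem_insert.1 ht with rfl | ht
    · right; rfl
    · left; exact hlt t ht
  · intro a ha b hb c hc hab hbc
    rcases Finset.mem_insert.1 hc with rfl | hc
    · have hb' : b ∈ T := by
        rcases Finset.mem_insert.1 hb with rfl | hb
        · omega
        · exact hb
      have ha' : a ∈ T := by
        rcases Finset.mem_insert.1 ha with rfl | ha
        · have := hlt _ hb'; omega
        · exact ha
      exact h2 a ha' b hb' hab
    · have := hlt c hc
      have hb' : b ∈ T := by
        rcases Finset.mem_insert.1 hb with rfl | hb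
        · omega
        · exact hb
      have ha' : a ∈ T := by
        rcases Finset.mem_insert.1 ha with rfl | ha
        · omega
        · exact ha
      exact htri a ha' b hb' c hc hab hbc

theorem ramsey_trans {U : ℕ → ℕ → ℕ → Prop} {m N : ℕ}
    (hN : 2 ^ ((m+1) * (m+1)) < N)
    (h1 : ∀ a b c d, a < b → b < c → c < d → d < N → U a b c → U b c d → U a b d ∧ U a c d)
    (h2 : ∀ a b c d, a < b → b < c → c < d → d < N → ¬ U a b c → ¬ U b c d →
      ¬ U a b d ∧ ¬ U a c d) :
    ∃ i j, i < j ∧ j < N ∧ (MonoEnd U m i j ∨ MonoEnd (fun a b c => ¬ U a b c) m i j) := by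
  classical
  by_contra hno
  push Not at hno
  obtain ⟨X, hX⟩ : ∃ X : (ℕ → ℕ → ℕ → Prop) → ℕ → ℕ → ℕ,
    X = fun V i j => Nat.findGreatest (fun n => MonoEnd V n i j) m := ⟨_, rfl⟩
  have hXle : ∀ V i j, X V i j ≤ m := by intro V i j; rw [hX]; exact Nat.findGreatest_le m
  have hXspec : ∀ V i j, i < j → MonoEnd V (X V i j) i j := by
    intro V i j hij
    rw [hX]
    exact Nat.findGreatest_spec (P := fun n => MonoEnd V n i j) (Nat.zero_le m) (monoEnd_zero V hij)
  have hXge : ∀ V n i j, n ≤ m → MonoEnd V n i j → n ≤ X V i j := by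
    intro V n i j hn h
    rw [hX]
    exact Nat.le_findGreatest (P := fun n => MonoEnd V n i j) hn h
  obtain ⟨lab, hlab⟩ : ∃ lab : ℕ → ℕ → ℕ × ℕ,
    lab = fun i j => (X U i j, X (fun a b c => ¬ U a b c) i j) := ⟨_, rfl⟩
  have hpig : ∃ x ∈ Finset.range N, ∃ y ∈ Finset.range N, x ≠ y ∧
      (Finset.range x).image (fun i => lab i x) = (Finset.range y).image (fun i => lab i y) := by
    refine Finset.exists_ne_map_eq_of_card_lt_of_maps_to
      (t := (Finset.range (m+1) ×ˢ Finset.range (m+1)).powerset) ?_ ?_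
    · rw [Finset.card_powerset, Finset.card_product, Finset.card_range, Finset.card_range]
      exact hN
    · intro x _
      simp only [Finset.coe_powerset, Set.mem_preimage, Set.mem_powerset_iff, Finset.coe_subset]
      intro y hy
      obtain ⟨i, _, rfl⟩ := Finset.mem_image.1 hy
      rw [hlab, Finset.mem_product, Finset.mem_range, Finset.mem_range]
      exact ⟨Nat.lt_succ_of_le (hXle _ _ _), Nat.lt_succ_of_le (hXle _ _ _)⟩
  have main : ∀ j k, j < k → k < N →
      (Finset.range j).image (fun i => lab i j) = (Finset.range k).image (fun i => lab i k) →
      False := by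
    intro j k hjk hk he
    have hm : lab j k ∈ (Finset.range k).image (fun i => lab i k) :=
      Finset.mem_image.2 ⟨j, Finset.mem_range.2 hjk, rfl⟩
    rw [← he] at hm
    obtain ⟨i, hi, hl⟩ := Finset.mem_image.1 hm
    rw [Finset.mem_range] at hi
    rw [hlab] at hl
    simp only [Prod.mk.injEq] at hl
    have key : ∀ V : ℕ → ℕ → ℕ → Prop, (∀ i j, i < j → j < N → ¬ MonoEnd V m i j) →
        (∀ a b c d, a < b → b < c → c < d → d < N → V a b c → V b c d → V a b d ∧ V a c d) →
        V i j k → X V i j = X V j k → False := by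
      intro V hV htr hv he
      have s1 := monoEnd_step htr hi hjk hk (hXspec V i j hi) hv
      have hne : X V i j ≠ m := by
        intro h
        have := hXspec V i j hi
        rw [h] at this
        exact hV i j hi (by omega) this
      have := hXle V i j
      have := hXge V _ j k (by omega) s1
      omega
    by_cases hU : U i j k
    · exact key U (fun i j h h' => (hno i j h h').1) h1 hU hl.1
    · exact key (fun a b c => ¬ U a b c) (fun i j h h' => (hno i j h h').2) h2 hU hl.2
  obtain ⟨x, hx, y, hy, hxy, he⟩ := hpig
  rw [Finset.mem_range] at hx hy
  rcases lt_or_gt_of_ne hxy with h | h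
  · exact main x y h hy he
  · exact main y x h hx he.symm

theorem ori_cup {ε : ℝ} {a b c d : Pt} (hab : a 0 + ε * a 1 < b 0 + ε * b 1)
    (hbc : b 0 + ε * b 1 < c 0 + ε * c 1) (hcd : c 0 + ε * c 1 < d 0 + ε * d 1)
    (h1 : 0 < ori a b c) (h2 : 0 < ori b c d) : 0 < ori a b d ∧ 0 < ori a c d := by
  have e1 : ori a b d * ((c 0 + ε * c 1) - (b 0 + ε * b 1)) =
      ori b c d * ((b 0 + ε * b 1) - (a 0 + ε * a 1)) +
      ori a b c * ((d 0 + ε * d 1) - (b 0 + ε * b 1)) := by unfold ori; ring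
  have e2 : ori a c d * ((c 0 + ε * c 1) - (b 0 + ε * b 1)) =
      ori b c d * ((c 0 + ε * c 1) - (a 0 + ε * a 1)) +
      ori a b c * ((d 0 + ε * d 1) - (c 0 + ε * c 1)) := by unfold ori; ring
  have p1 : 0 < ori a b d * ((c 0 + ε * c 1) - (b 0 + ε * b 1)) := by
    rw [e1]
    exact add_pos (mul_pos h2 (by linarith)) (mul_pos h1 (by linarith))
  have p2 : 0 < ori a c d * ((c 0 + ε * c 1) - (b 0 + ε * b 1)) := by
    rw [e2]
    exact add_pos (mul_pos h2 (by linarith)) (mul_pos h1 (by linarith))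
  exact ⟨pos_of_mul_pos_left p1 (by linarith), pos_of_mul_pos_left p2 (by linarith)⟩

theorem ori_cap {ε : ℝ} {a b c d : Pt} (hab : a 0 + ε * a 1 < b 0 + ε * b 1)
    (hbc : b 0 + ε * b 1 < c 0 + ε * c 1) (hcd : c 0 + ε * c 1 < d 0 + ε * d 1)
    (h1 : ori a b c < 0) (h2 : ori b c d < 0) : ori a b d < 0 ∧ ori a c d < 0 := by
  have e1 : ori a b d * ((c 0 + ε * c 1) - (b 0 + ε * b 1)) =
      ori b c d * ((b 0 + ε * b 1) - (a 0 + ε * a 1)) +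
      ori a b c * ((d 0 + ε * d 1) - (b 0 + ε * b 1)) := by unfold ori; ring
  have e2 : ori a c d * ((c 0 + ε * c 1) - (b 0 + ε * b 1)) =
      ori b c d * ((c 0 + ε * c 1) - (a 0 + ε * a 1)) +
      ori a b c * ((d 0 + ε * d 1) - (c 0 + ε * c 1)) := by unfold ori; ring
  have p1 : ori a b d * ((c 0 + ε * c 1) - (b 0 + ε * b 1)) < 0 := by
    rw [e1]
    exact add_neg (mul_neg_of_neg_of_pos h2 (by linarith)) (mul_neg_of_neg_of_pos h1 (by linarith))
  have p2 : ori a c d * ((c 0 + ε * c 1) - (b 0 + ε * b 1)) < 0 := by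
    rw [e2]
    exact add_neg (mul_neg_of_neg_of_pos h2 (by linarith)) (mul_neg_of_neg_of_pos h1 (by linarith))
  have hp : 0 < (c 0 + ε * c 1) - (b 0 + ε * b 1) := by linarith
  constructor
  · by_contra h; push Not at h; nlinarith [mul_nonneg h hp.le]
  · by_contra h; push Not at h; nlinarith [mul_nonneg h hp.le]

theorem es_finite (m : ℕ) (hm : 3 ≤ m) (P : Finset Pt) (hg : GenPos P)
    (hN : 2 ^ ((m+1) * (m+1)) < P.card) : HasConvex P m := by
  obtain ⟨ε, hε⟩ := exists_phi P
  obtain ⟨e, he1, he2⟩ := sort_lemma P (Finset.card_pos.1 (lt_of_le_of_lt (Nat.zero_le _) hN)) (fun a => a 0 + ε * a 1) (by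
    intro a ha b hb hab
    by_contra hne
    exact hε a ha b hb hne hab)
  have hne : ∀ i j, i < j → j < P.card → e i ≠ e j := by
    intro i j hij hj h
    have := he2 i j hij hj
    rw [h] at this; exact lt_irrefl _ this
  have hnz : ∀ a b c, a < b → b < c → c < P.card → ori (e a) (e b) (e c) ≠ 0 := by
    intro a b c hab hbc hc
    exact genPos_ori hg (he1 a) (he1 b) (he1 c) (hne a b hab (by omega)) (hne b c hbc hc)
      (hne a c (by omega) hc)
  have hneg : ∀ a b c, a < b → b < c → c < P.card → ¬ 0 < ori (e a) (e b) (e c) →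
      ori (e a) (e b) (e c) < 0 := by
    intro a b c hab hbc hc h
    exact lt_of_le_of_ne (not_lt.1 h) (hnz a b c hab hbc hc)
  -- conclusion from positive sequences
  have fin : ∀ q : ℕ → Pt, (∀ i, q i ∈ P) → PosSeq m q → HasConvex P m := by
    intro q hq hpos
    refine ⟨(Finset.range m).image q, ?_, ?_, posSeq_convex hm hpos⟩
    · intro x hx
      obtain ⟨i, _, rfl⟩ := Finset.mem_image.1 hx
      exact hq i
    · rw [Finset.card_image_of_injOn (posSeq_inj hm hpos), Finset.card_range]
  have getT : ∀ V : ℕ → ℕ → ℕ → Prop, ∀ i j, i < j → j < P.card → MonoEnd V m i j →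
      ∃ r : ℕ → ℕ, ∀ a b c, a < b → b < c → c < m → 
        r a < r b ∧ r b < r c ∧ r c < P.card ∧ V (r a) (r b) (r c) := by
    rintro V i j hij hj ⟨T, hi, hjT, hcard, hle, htri⟩
    obtain ⟨r, hr1, hr2⟩ := sort_lemma T ⟨i, hi⟩ (fun n : ℕ => (n : ℝ)) (by
      intro a _ b _ h; exact Nat.cast_injective (R := ℝ) h)
    refine ⟨r, fun a b c hab hbc hc => ?_⟩
    have s1 : r a < r b := by exact_mod_cast hr2 a b hab (by omega)
    have s2 : r b < r c := by exact_mod_cast hr2 b c hbc (by omega)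
    refine ⟨s1, s2, ?_, htri _ (hr1 a) _ (hr1 b) _ (hr1 c) s1 s2⟩
    have := hle _ (hr1 c); omega
  obtain ⟨i, j, hij, hj, h⟩ := ramsey_trans (U := fun a b c => 0 < ori (e a) (e b) (e c)) hN
    (by
      intro a b c d hab hbc hcd hd h1 h2
      exact ori_cup (he2 a b hab (by omega)) (he2 b c hbc (by omega)) (he2 c d hcd hd) h1 h2)
    (by
      intro a b c d hab hbc hcd hd h1 h2
      have := ori_cap (he2 a b hab (by omega)) (he2 b c hbc (by omega)) (he2 c d hcd hd)
        (hneg a b c hab hbc (by omega) h1) (hneg b c d hbc hcd hd h2)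
      exact ⟨not_lt.2 this.1.le, not_lt.2 this.2.le⟩)
  rcases h with h | h
  · obtain ⟨r, hr⟩ := getT _ i j hij hj h
    exact fin (fun t => e (r t)) (fun t => he1 _) (fun a b c hab hbc hc => (hr a b c hab hbc hc).2.2.2)
  · obtain ⟨r, hr⟩ := getT _ i j hij hj h
    refine fin (fun t => e (r (m - 1 - t))) (fun t => he1 _) (fun a b c hab hbc hc => ?_)
    obtain ⟨s1, s2, s3, s4⟩ := hr (m-1-c) (m-1-b) (m-1-a) (by omega) (by omega) (by omega)
    have := hneg _ _ _ s1 s2 s3 s4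
    have e3 : ∀ x y z : Pt, ori x y z = - ori z y x := by intro x y z; unfold ori; ring
    rw [e3]
    linarith

theorem ev_ne {A B C : ℝ} (h : A ≠ 0 ∨ B ≠ 0 ∨ C ≠ 0) :
    ∀ᶠ δ in nhdsWithin (0:ℝ) (Set.Ioi 0), A + δ * B + δ ^ 2 * C ≠ 0 := by
  have hpos : ∀ᶠ δ in nhdsWithin (0:ℝ) (Set.Ioi 0), 0 < δ := self_mem_nhdsWithin
  have cont : ∀ X Y Z : ℝ, X ≠ 0 → ∀ᶠ δ in nhdsWithin (0:ℝ) (Set.Ioi 0),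
      X + δ * Y + δ ^ 2 * Z ≠ 0 := by
    intro X Y Z hX
    have hc : Continuous (fun δ : ℝ => X + δ * Y + δ ^ 2 * Z) := by fun_prop
    have := hc.continuousAt.eventually_ne (x := 0) (y := 0) (by simpa using hX)
    exact this.filter_mono nhdsWithin_le_nhds
  by_cases hA : A = 0
  · by_cases hB : B = 0
    · have hC : C ≠ 0 := by tauto
      filter_upwards [hpos] with δ hδ
      rw [hA, hB]
      simp [hC, hδ.ne']
    · filter_upwards [hpos, cont B C 0 hB] with δ hδ h1
      have : A + δ * B + δ ^ 2 * C = δ * (B + δ * C + δ ^ 2 * 0) := by rw [hA]; ring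
      rw [this]
      exact mul_ne_zero hδ.ne' h1
  · exact cont A B C hA

theorem ev_neg {A B C : ℝ} (h : A < 0) :
    ∀ᶠ δ in nhdsWithin (0:ℝ) (Set.Ioi 0), A + δ * B + δ ^ 2 * C < 0 := by
  have hc : Continuous (fun δ : ℝ => A + δ * B + δ ^ 2 * C) := by fun_prop
  have := hc.continuousAt.eventually_lt (x₀ := 0) (continuousAt_const (y := (0:ℝ))) (by simpa using h)
  exact this.filter_mono nhdsWithin_le_nhds

theorem perturb (P : Finset Pt) : ∃ π : Pt → Pt, Set.InjOn π (P : Set Pt) ∧ GenPos (P.image π) ∧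
    ∀ a ∈ P, ∀ b ∈ P, ∀ c ∈ P, 0 < ori (π a) (π b) (π c) → 0 ≤ ori a b c := by
  obtain ⟨ε, hε⟩ := exists_phi P
  obtain ⟨s, hs⟩ : ∃ s : Pt → ℝ, s = fun a => a 0 + ε * a 1 := ⟨_, rfl⟩
  have hsne : ∀ a ∈ P, ∀ b ∈ P, a ≠ b → s a ≠ s b := by
    intro a ha b hb hab; rw [hs]; exact hε a ha b hb hab
  have hori : ∀ (δ : ℝ) (a b c : Pt),
      ori (!₂[a 0 + δ * s a, a 1 + δ * s a ^ 2]) (!₂[b 0 + δ * s b, b 1 + δ * s b ^ 2])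
        (!₂[c 0 + δ * s c, c 1 + δ * s c ^ 2]) = ori a b c + δ * ((b 0 - a 0) * (s c ^ 2 - s a ^ 2)
        + (s b - s a) * (c 1 - a 1) - (b 1 - a 1) * (s c - s a) - (s b ^ 2 - s a ^ 2) * (c 0 - a 0))
        + δ ^ 2 * ((s b - s a) * (s c - s a) * (s c - s b)) := by
    intro δ a b c
    simp [ori]; ring
  have e1 : ∀ᶠ δ in nhdsWithin (0:ℝ) (Set.Ioi 0), ∀ a ∈ P, ∀ b ∈ P, a ≠ b →
      (a 0 - b 0) + δ * (s a - s b) + δ ^ 2 * 0 ≠ 0 := by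
    rw [Filter.eventually_all_finset]; intro a ha
    rw [Filter.eventually_all_finset]; intro b hb
    rw [Filter.eventually_imp_distrib_left]; intro hab
    exact ev_ne (Or.inr (Or.inl (sub_ne_zero.2 (hsne a ha b hb hab))))
  have e2 : ∀ᶠ δ in nhdsWithin (0:ℝ) (Set.Ioi 0), ∀ a ∈ P, ∀ b ∈ P, ∀ c ∈ P,
      a ≠ b → b ≠ c → a ≠ c → ori (!₂[a 0 + δ * s a, a 1 + δ * s a ^ 2])
        (!₂[b 0 + δ * s b, b 1 + δ * s b ^ 2]) (!₂[c 0 + δ * s c, c 1 + δ * s c ^ 2]) ≠ 0 := by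
    rw [Filter.eventually_all_finset]; intro a ha
    rw [Filter.eventually_all_finset]; intro b hb
    rw [Filter.eventually_all_finset]; intro c hc
    rw [Filter.eventually_imp_distrib_left]; intro hab
    rw [Filter.eventually_imp_distrib_left]; intro hbc
    rw [Filter.eventually_imp_distrib_left]; intro hac
    simp only [hori]
    refine ev_ne (Or.inr (Or.inr ?_))
    have h1 := sub_ne_zero.2 (hsne a ha b hb hab).symm
    have h2 := sub_ne_zero.2 (hsne b hb c hc hbc).symm
    have h3 := sub_ne_zero.2 (hsne a ha c hc hac).symm
    exact mul_ne_zero (mul_ne_zero h1 h3) h2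
  have e3 : ∀ᶠ δ in nhdsWithin (0:ℝ) (Set.Ioi 0), ∀ a ∈ P, ∀ b ∈ P, ∀ c ∈ P,
      ori a b c < 0 → ori (!₂[a 0 + δ * s a, a 1 + δ * s a ^ 2])
        (!₂[b 0 + δ * s b, b 1 + δ * s b ^ 2]) (!₂[c 0 + δ * s c, c 1 + δ * s c ^ 2]) < 0 := by
    rw [Filter.eventually_all_finset]; intro a ha
    rw [Filter.eventually_all_finset]; intro b hb
    rw [Filter.eventually_all_finset]; intro c hc
    rw [Filter.eventually_imp_distrib_left]; intro habc
    simp only [hori]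
    exact ev_neg habc
  obtain ⟨δ, d1, d2, d3⟩ := (e1.and (e2.and e3)).exists
  refine ⟨fun a => !₂[a 0 + δ * s a, a 1 + δ * s a ^ 2], ?_, ?_, ?_⟩
  · intro a ha b hb hab
    by_contra hne
    apply d1 a ha b hb hne
    have := congrArg (fun x : Pt => x 0) hab
    simp at this
    linarith
  · apply genPos_of_ori
    intro a ha b hb c hc hab hbc hac
    obtain ⟨a, ma, rfl⟩ := Finset.mem_image.1 ha
    obtain ⟨b, mb, rfl⟩ := Finset.mem_image.1 hb
    obtain ⟨c, mc, rfl⟩ := Finset.mem_image.1 hc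
    exact d2 a ma b mb c mc (fun h => hab (by rw [h])) (fun h => hbc (by rw [h]))
      (fun h => hac (by rw [h]))
  · intro a ha b hb c hc h
    by_contra hcon
    exact absurd (d3 a ha b hb c hc (not_le.1 hcon)) (not_lt.2 h.le)

theorem stmt11 (l k : ℕ) (hl : 3 ≤ l) (hk : 4 ≤ k) (heven : Even k)
    (P : Finset Pt) (hP : ES ((k - 2) * (l - 1) / 2 + 2) ≤ P.card) :
    HasCollinear P l ∨ HasStrictConvex P k := by
  obtain ⟨j, hj⟩ := heven
  obtain rfl : k = 2 * j := by omega
  have hm : (2 * j - 2) * (l - 1) / 2 + 2 = (j - 1) * (l - 1) + 2 := by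
    rw [(by omega : 2 * j - 2 = 2 * (j - 1)), mul_assoc, Nat.mul_div_cancel_left _ (by norm_num)]
  rw [hm] at hP
  obtain ⟨m, hmd⟩ : ∃ m, m = (j - 1) * (l - 1) + 2 := ⟨_, rfl⟩
  rw [← hmd] at hP
  have hm3 : 3 ≤ m := by
    have : 1 ≤ (j-1) * (l-1) := Nat.mul_pos (by omega) (by omega)
    omega
  have hES : ∀ P : Finset Pt, GenPos P → ES m ≤ P.card → HasConvex P m :=
    Nat.sInf_mem (s := {n : ℕ | ∀ P : Finset Pt, GenPos P → n ≤ P.card → HasConvex P m})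
      ⟨2 ^ ((m+1) * (m+1)) + 1, fun Q hQ hc => es_finite m hm3 Q hQ hc⟩
  by_cases hcol : HasCollinear P l
  · exact Or.inl hcol
  right
  obtain ⟨π, hinj, hgen, hsign⟩ := perturb P
  obtain ⟨S, hSP, hSc, hSconv⟩ := hES (P.image π) hgen
    (by rw [Finset.card_image_of_injOn hinj]; exact hP)
  have hSg : GenPos S := fun T hT => hgen T (hT.trans hSP)
  obtain ⟨q', hq1, hq2⟩ := order_convex (by omega) hSg hSconv
  rw [hSc] at hq2
  have hpre : ∀ i, ∃ x ∈ P, π x = q' i := fun i => Finset.mem_image.1 (hSP (hq1 i))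
  choose q hqP hqe using hpre
  have hne : ∀ a b, a < b → b < m → q a ≠ q b := by
    intro a b hab hb h
    refine posSeq_ne hm3 hq2 hab hb ?_
    rw [← hqe, ← hqe, h]
  obtain ⟨g, hg1, hg2⟩ := weak_main (q := q) (l := l) (m := m) (j := j) hl (by omega) hmd hne
    (by
      intro a b c hab hbc hc
      refine hsign _ (hqP a) _ (hqP b) _ (hqP c) ?_
      rw [hqe, hqe, hqe]
      exact hq2 a b c hab hbc hc)
    (by
      intro T hT hTc
      by_contra hno
      push Not at hno
      apply hcol
      refine ⟨T.image q, ?_, ?_, ?_⟩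
      · intro x hx
        obtain ⟨i, _, rfl⟩ := Finset.mem_image.1 hx
        exact hqP i
      · rw [Finset.card_image_of_injOn, hTc]
        intro a ha b hb he
        have ha' := Finset.mem_range.1 (hT ha)
        have hb' := Finset.mem_range.1 (hT hb)
        rcases lt_trichotomy a b with h | h | h
        · exact absurd he (hne a b h hb')
        · exact h
        · exact absurd he.symm (hne b a h ha')
      · apply col_of_ori
        intro a ha b hb c hc
        obtain ⟨a, ma, rfl⟩ := Finset.mem_image.1 (Finset.mem_coe.1 ha)
        obtain ⟨b, mb, rfl⟩ := Finset.mem_image.1 (Finset.mem_coe.1 hb)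
        obtain ⟨c, mc, rfl⟩ := Finset.mem_image.1 (Finset.mem_coe.1 hc)
        exact hno a ma b mb c mc)
  refine ⟨(Finset.range (2 * j)).image (fun t => q (g t)), ?_, ?_, posSeq_strict (by omega) hg2⟩
  · intro x hx
    obtain ⟨i, _, rfl⟩ := Finset.mem_image.1 hx
    exact hqP _
  · rw [Finset.card_image_of_injOn (posSeq_inj (by omega) hg2), Finset.card_range]
end
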